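/- (Parabolic rescaling) There is an absolute constant c such that for every real p with 4 < p < 6, all real numbers 0 < δ < σ ≤ 1 with 1/δ ∈ ℕ and σ/δ ∈ ℕ, and every interval I ⊆ [0,1] of length σ with |I|/δ ∈ ℕ, one has ‖E_I g‖_{L^p(B)} ≤ c · D_p(δ/σ) · (Σ_{J ∈ P_δ(I)} ‖E_J g‖_{L^p(w_B)}²)^{1/2} for every integrable g : [0,1] → ℂ and every axis-parallel square B ⊂ ℝ² of side length δ^{−2}. -/

import Mathlib

open MeasureTheory

noncomputable section

/-- The weight `w_B` attached to the axis-parallel square of center `c` and side length `R`: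
`w_B(x) = (1 + |x - c|/R)^(-100)` with `|·|` the Euclidean norm on `ℝ²`. -/
def wB (c : ℝ × ℝ) (R : ℝ) (x : ℝ × ℝ) : ℝ :=
  (1 + Real.sqrt ((x.1 - c.1) ^ 2 + (x.2 - c.2) ^ 2) / R) ^ (-100 : ℤ)

/-- The product weight `w̃_B(x) = (1 + |x₁ - c₁|/R)^(-100) * (1 + |x₂ - c₂|/R)^(-100)`. -/
def wtB (c : ℝ × ℝ) (R : ℝ) (x : ℝ × ℝ) : ℝ :=
  (1 + |x.1 - c.1| / R) ^ (-100 : ℤ) * (1 + |x.2 - c.2| / R) ^ (-100 : ℤ)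

/-- The axis-parallel square `B(c, R)` with center `c` and side length `R`, as a subset of `ℝ²`. -/
def sqr (c : ℝ × ℝ) (R : ℝ) : Set (ℝ × ℝ) :=
  Set.Icc (c.1 - R / 2) (c.1 + R / 2) ×ˢ Set.Icc (c.2 - R / 2) (c.2 + R / 2)

/-- The extension operator associated to the parabola, over the interval `[a, b]`:
`(E_{[a,b]} g)(x) = ∫_{[a,b]} g(ξ) e(ξ x₁ + ξ² x₂) dξ`. -/
def extOp (a b : ℝ) (g : ℝ → ℂ) (x : ℝ × ℝ) : ℂ :=
  ∫ ξ in Set.Icc a b,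
    g ξ * Complex.exp (2 * Real.pi * Complex.I * ((ξ * x.1 + ξ ^ 2 * x.2 : ℝ) : ℂ))

/-- Weighted `L^p` norm `‖f‖_{L^p(w)} = (∫_{ℝ²} |f|^p w)^{1/p}`. -/
def wLp (p : ℝ) (w : ℝ × ℝ → ℝ) (f : ℝ × ℝ → ℂ) : ℝ :=
  (∫ x : ℝ × ℝ, ‖f x‖ ^ p * w x) ^ (1 / p)

/-- `L^p` norm over the square of center `c` and side `R`. -/
def sqLp (p : ℝ) (c : ℝ × ℝ) (R : ℝ) (f : ℝ × ℝ → ℂ) : ℝ :=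
  (∫ x in sqr c R, ‖f x‖ ^ p) ^ (1 / p)

/-- Normalized weighted `L^p` norm `‖f‖_{L^p_#(w)} = (|B|⁻¹ ∫_{ℝ²} |f|^p w)^{1/p}` where the
normalizing square has side length `R` (so `|B| = R²`). -/
def shLp (p R : ℝ) (w : ℝ × ℝ → ℝ) (f : ℝ × ℝ → ℂ) : ℝ :=
  ((R ^ 2)⁻¹ * ∫ x : ℝ × ℝ, ‖f x‖ ^ p * w x) ^ (1 / p)

/-- Normalized `L^p` norm over the square of center `c` and side `R`:
`‖f‖_{L^p_#(B)} = (|B|⁻¹ ∫_B |f|^p)^{1/p}`. -/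
def shLpSq (p : ℝ) (c : ℝ × ℝ) (R : ℝ) (f : ℝ × ℝ → ℂ) : ℝ :=
  ((R ^ 2)⁻¹ * ∫ x in sqr c R, ‖f x‖ ^ p) ^ (1 / p)

/-- `DecIneq p n D` says that the constant `D` is admissible in the `l²L^p` decoupling
inequality for the parabola at scale `δ = 1/n`: for every integrable `g : [0,1] → ℂ` and every
axis-parallel square `B` of side length `δ⁻² = n²`,
`‖E_{[0,1]} g‖_{L^p(B)} ≤ D (Σ_{J ∈ P_δ([0,1])} ‖E_J g‖_{L^p(w_B)}²)^{1/2}`. -/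
def DecIneq (p : ℝ) (n : ℕ) (D : ℝ) : Prop :=
  ∀ g : ℝ → ℂ, IntegrableOn g (Set.Icc 0 1) → ∀ c : ℝ × ℝ,
    sqLp p c ((n : ℝ) ^ 2) (extOp 0 1 g) ≤
      D * (∑ k ∈ Finset.range n,
        wLp p (wB c ((n : ℝ) ^ 2)) (extOp ((k : ℝ) / (n : ℝ)) (((k : ℝ) + 1) / (n : ℝ)) g) ^ 2)
        ^ (1 / 2 : ℝ)

/-- The decoupling constant `D_p(δ)` for the parabola at scale `δ = 1/n`, i.e. the smallest
admissible constant in the decoupling inequality. -/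
def Dconst (p : ℝ) (n : ℕ) : ℝ := sInf {D : ℝ | 0 ≤ D ∧ DecIneq p n D}

/-- Center of the `(i,j)` square in the partition of the axis-parallel square of center `c` and
side length `Rb` into axis-parallel squares of side length `r`. -/
def subCtr (c : ℝ × ℝ) (Rb r : ℝ) (i j : ℕ) : ℝ × ℝ :=
  (c.1 - Rb / 2 + ((i : ℝ) + 1 / 2) * r, c.2 - Rb / 2 + ((j : ℝ) + 1 / 2) * r)

/-- `BilIneq p n k b M` says `M` is admissible in the bilinear decoupling inequality with
`δ = 1/n`, `ν = 1/k`: for every square `B` of side `δ⁻² = n²`, every integrable `g`, and all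
`ν`-separated intervals `I = [i/k, (i+1)/k]`, `I' = [i'/k, (i'+1)/k]` of the partition
`P_ν([0,1])`,
`Avg_{Δ ∈ P_{ν^{-b}}(B)} Π (Σ_{J ∈ P_{ν^b}} ‖E_J g‖_{L²_#(w̃_Δ)}²)^{p/4}
  ≤ M^p Π (Σ_{J ∈ P_δ} ‖E_J g‖_{L^p_#(w_B)}²)^{p/4}`. -/
def BilIneq (p : ℝ) (n k b : ℕ) (M : ℝ) : Prop :=
  ∀ g : ℝ → ℂ, IntegrableOn g (Set.Icc 0 1) → ∀ c : ℝ × ℝ,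
    ∀ i i' : ℕ, i < k → i' < k → (i + 1 < i' ∨ i' + 1 < i) →
    (((n ^ 2 / k ^ b : ℕ) : ℝ) ^ 2)⁻¹ *
        ∑ a ∈ Finset.range (n ^ 2 / k ^ b), ∑ a' ∈ Finset.range (n ^ 2 / k ^ b),
          ((∑ J ∈ Finset.range (k ^ (b - 1)),
              shLp 2 ((k : ℝ) ^ b)
                (wtB (subCtr c ((n : ℝ) ^ 2) ((k : ℝ) ^ b) a a') ((k : ℝ) ^ b))
                (extOp ((i : ℝ) / (k : ℝ) + (J : ℝ) / (k : ℝ) ^ b)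
                  ((i : ℝ) / (k : ℝ) + ((J : ℝ) + 1) / (k : ℝ) ^ b) g) ^ 2) ^ (p / 4) *
            (∑ J ∈ Finset.range (k ^ (b - 1)),
              shLp 2 ((k : ℝ) ^ b)
                (wtB (subCtr c ((n : ℝ) ^ 2) ((k : ℝ) ^ b) a a') ((k : ℝ) ^ b))
                (extOp ((i' : ℝ) / (k : ℝ) + (J : ℝ) / (k : ℝ) ^ b)
                  ((i' : ℝ) / (k : ℝ) + ((J : ℝ) + 1) / (k : ℝ) ^ b) g) ^ 2) ^ (p / 4))
      ≤ M ^ p *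
        ((∑ J ∈ Finset.range (n / k),
            shLp p ((n : ℝ) ^ 2) (wB c ((n : ℝ) ^ 2))
              (extOp ((i : ℝ) / (k : ℝ) + (J : ℝ) / (n : ℝ))
                ((i : ℝ) / (k : ℝ) + ((J : ℝ) + 1) / (n : ℝ)) g) ^ 2) ^ (p / 4) *
          (∑ J ∈ Finset.range (n / k),
            shLp p ((n : ℝ) ^ 2) (wB c ((n : ℝ) ^ 2))
              (extOp ((i' : ℝ) / (k : ℝ) + (J : ℝ) / (n : ℝ))
                ((i' : ℝ) / (k : ℝ) + ((J : ℝ) + 1) / (n : ℝ)) g) ^ 2) ^ (p / 4))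

/-- The bilinear decoupling constant `M_{p,b}(δ, ν)` with `δ = 1/n`, `ν = 1/k`. -/
def Mconst (p : ℝ) (n k b : ℕ) : ℝ := sInf {M : ℝ | 0 ≤ M ∧ BilIneq p n k b M}

/-- The Fourier transform of a function on `ℝ²`. -/
def ftR2 (η : ℝ × ℝ → ℝ) (ξ : ℝ × ℝ) : ℂ :=
  ∫ x : ℝ × ℝ, (η x : ℂ) * Complex.exp (-(2 * Real.pi * Complex.I) * ((x.1 * ξ.1 + x.2 * ξ.2 : ℝ) : ℂ))

end

open scoped ENNReal NNReal FourierTransform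

/-- The `ℓ²` norm of a finite family of `L^p` norms, to the power `p`, in terms of the `p`-th powers
of these norms. -/
noncomputable def lpSq (p : ℝ) (m : ℕ) (A : ℕ → ℝ≥0∞) : ℝ≥0∞ :=
  (∑ k ∈ Finset.range m, A k ^ (2 / p)) ^ (p / 2)

lemma lpSq_mono {p : ℝ} (hp : 0 < p) {m : ℕ} {A B : ℕ → ℝ≥0∞} (h : ∀ k < m, A k ≤ B k) :
    lpSq p m A ≤ lpSq p m B := by
  unfold lpSq
  refine ENNReal.rpow_le_rpow (Finset.sum_le_sum fun k hk => ?_) (by positivity)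
  exact ENNReal.rpow_le_rpow (h k (Finset.mem_range.1 hk)) (by positivity)

lemma lpSq_const_mul {p : ℝ} (hp : 0 < p) (m : ℕ) (c : ℝ≥0∞) (A : ℕ → ℝ≥0∞) :
    lpSq p m (fun k => c * A k) = c * lpSq p m A := by
  unfold lpSq
  simp_rw [ENNReal.mul_rpow_of_nonneg _ _ (show 0 ≤ 2 / p by positivity)]
  rw [← Finset.mul_sum, ENNReal.mul_rpow_of_nonneg _ _ (show 0 ≤ p / 2 by positivity),
    ← ENNReal.rpow_mul]
  rw [show 2 / p * (p / 2) = 1 by field_simp, ENNReal.rpow_one]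

lemma le_lpSq {p : ℝ} (hp : 0 < p) {m k : ℕ} (hk : k < m) (A : ℕ → ℝ≥0∞) :
    A k ≤ lpSq p m A := by
  unfold lpSq
  calc A k = (A k ^ (2 / p)) ^ (p / 2) := by
        rw [← ENNReal.rpow_mul, show 2 / p * (p / 2) = 1 by field_simp, ENNReal.rpow_one]
    _ ≤ _ := ENNReal.rpow_le_rpow
        (Finset.single_le_sum (f := fun k => A k ^ (2 / p)) (fun _ _ => zero_le)
          (Finset.mem_range.2 hk)) (by positivity)

lemma lintegral_Lp_sum_le {α : Type*} [MeasurableSpace α] {μ : Measure α} {q : ℝ} (hq : 1 ≤ q)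
    (s : Finset ℕ) {f : ℕ → α → ℝ≥0∞} (hf : ∀ k, Measurable (f k)) :
    (∫⁻ a, (∑ k ∈ s, f k a) ^ q ∂μ) ^ (1 / q) ≤ ∑ k ∈ s, (∫⁻ a, f k a ^ q ∂μ) ^ (1 / q) := by
  induction s using Finset.induction_on with
  | empty => simp [show 0 < q by linarith]
  | insert k s hk ih =>
    simp_rw [Finset.sum_insert hk]
    refine (ENNReal.lintegral_Lp_add_le (f := f k) (g := fun a => ∑ k ∈ s, f k a)
      (hf k).aemeasurable (Finset.measurable_sum s fun i _ => hf i).aemeasurable hq).trans ?_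
    gcongr

/-- Minkowski's inequality for `lpSq`. -/
lemma lintegral_lpSq_le {α : Type*} [MeasurableSpace α] {μ : Measure α} {p : ℝ} (hp : 2 ≤ p)
    (m : ℕ) {A : ℕ → α → ℝ≥0∞} (hA : ∀ k, Measurable (A k)) :
    ∫⁻ a, lpSq p m (fun k => A k a) ∂μ ≤ lpSq p m (fun k => ∫⁻ a, A k a ∂μ) := by
  have h := lintegral_Lp_sum_le (μ := μ) (q := p / 2) (by linarith) (Finset.range m)
    (f := fun k a => A k a ^ (2 / p)) (fun k => (hA k).pow_const _)
  have hp0 : 0 < p := by linarith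
  have e : ∀ x : ℝ≥0∞, (x ^ (2 / p)) ^ (p / 2) = x := fun x => by
    rw [← ENNReal.rpow_mul, show 2 / p * (p / 2) = 1 by field_simp, ENNReal.rpow_one]
  simp_rw [e] at h
  have h2 := ENNReal.rpow_le_rpow h (show 0 ≤ p / 2 by positivity)
  rw [← ENNReal.rpow_mul, show 1 / (p / 2) * (p / 2) = 1 by field_simp, ENNReal.rpow_one] at h2
  simpa [lpSq, show 1 / (p / 2) = 2 / p by field_simp] using h2

/-- Hölder's inequality for an average with weight `a`. -/
lemma lintegral_mul_rpow_le {α : Type*} [MeasurableSpace α] {μ : Measure α} {p : ℝ} (hp : 1 < p)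
    {a f : α → ℝ≥0∞} (ha : Measurable a) (hf : Measurable f) :
    (∫⁻ x, a x * f x ∂μ) ^ p ≤ (∫⁻ x, a x ∂μ) ^ (p - 1) * ∫⁻ x, a x * f x ^ p ∂μ := by
  have hp0 : 0 < p := by linarith
  have hpq := Real.HolderConjugate.conjExponent hp
  set q := p.conjExponent
  have hq0 : 0 < q := hpq.symm.pos
  have h := ENNReal.lintegral_mul_le_Lp_mul_Lq μ hpq.symm
    (f := fun x => a x ^ (1 / q)) (g := fun x => a x ^ (1 / p) * f x)
    (ha.pow_const _).aemeasurable ((ha.pow_const _).mul hf).aemeasurable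
  have e1 : ∀ x, ((fun x => a x ^ (1 / q)) * fun x => a x ^ (1 / p) * f x) x = a x * f x := by
    intro x
    simp only [Pi.mul_apply]
    rw [← mul_assoc, ← ENNReal.rpow_add_of_nonneg _ _ (by positivity) (by positivity)]
    have := hpq.symm.inv_add_inv_eq_one
    rw [one_div, one_div, this, ENNReal.rpow_one]
  have e2 : ∀ x, (a x ^ (1 / q)) ^ q = a x := fun x => by
    rw [← ENNReal.rpow_mul, one_div_mul_cancel hq0.ne', ENNReal.rpow_one]
  have e3 : ∀ x, (a x ^ (1 / p) * f x) ^ p = a x * f x ^ p := fun x => by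
    rw [ENNReal.mul_rpow_of_nonneg _ _ hp0.le, ← ENNReal.rpow_mul, one_div_mul_cancel hp0.ne',
      ENNReal.rpow_one]
  simp_rw [e1, e2, e3] at h
  have h2 := ENNReal.rpow_le_rpow h hp0.le
  rw [ENNReal.mul_rpow_of_nonneg _ _ hp0.le, ← ENNReal.rpow_mul, ← ENNReal.rpow_mul,
    one_div_mul_cancel hp0.ne', ENNReal.rpow_one] at h2
  have : 1 / q * p = p - 1 := by
    have := hpq.symm.inv_add_inv_eq_one
    have h3 : q⁻¹ = 1 - p⁻¹ := by linarith
    rw [one_div, h3]; field_simp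
  rwa [this] at h2

/-- The weight `(1 + |x|)^{-N}` on the line. -/
noncomputable def decay (N : ℕ) (x : ℝ) : ℝ≥0∞ := ENNReal.ofReal (((1 + |x|) ^ N)⁻¹)

/-- The weight `(1 + |x|)^N` on the line. -/
noncomputable def growth (N : ℕ) (x : ℝ) : ℝ≥0∞ := ENNReal.ofReal ((1 + |x|) ^ N)

@[fun_prop]
lemma measurable_decay (N : ℕ) : Measurable (decay N) := by unfold decay; fun_prop

@[fun_prop]
lemma measurable_growth (N : ℕ) : Measurable (growth N) := by unfold growth; fun_prop

lemma decay_add (a b : ℕ) (x : ℝ) : decay (a + b) x = decay a x * decay b x := by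
  unfold decay
  rw [← ENNReal.ofReal_mul (by positivity), pow_add, mul_inv]

lemma one_le_growth (N : ℕ) (x : ℝ) : 1 ≤ growth N x := by
  unfold growth
  rw [ENNReal.one_le_ofReal]
  exact one_le_pow₀ (by linarith [abs_nonneg x])

lemma growth_mul_decay (N : ℕ) (x : ℝ) : growth N x * decay N x = 1 := by
  unfold decay growth
  rw [← ENNReal.ofReal_mul (by positivity), mul_inv_cancel₀ (by positivity), ENNReal.ofReal_one]

lemma growth_add_le (N : ℕ) (x y : ℝ) : growth N (x + y) ≤ growth N x * growth N y := by
  unfold growth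
  rw [← ENNReal.ofReal_mul (by positivity), ← mul_pow]
  gcongr
  nlinarith [abs_add_le x y, abs_nonneg x, abs_nonneg y, mul_nonneg (abs_nonneg x) (abs_nonneg y)]

lemma lintegral_decay_lt_top {N : ℕ} (hN : 2 ≤ N) : ∫⁻ x, decay N x < ⊤ := by
  have h := (integrable_one_add_norm (E := ℝ) (μ := volume) (r := N)
    (by simp; omega)).lintegral_lt_top
  refine lt_of_le_of_lt (lintegral_mono fun x => ?_) h
  unfold decay
  rw [Real.norm_eq_abs, Real.rpow_neg (by positivity), Real.rpow_natCast]

/-- Schwartz functions decay rapidly. -/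
lemma schwartz_enorm_le (φ : SchwartzMap ℝ ℂ) (N : ℕ) :
    ∃ C : ℝ≥0, ∀ x, ‖φ x‖ₑ ≤ C * decay N x := by
  set K : ℝ := 2 ^ N * ((Finset.Iic (N, 0)).sup
    fun m : ℕ × ℕ => SchwartzMap.seminorm ℝ (F := ℂ) (E := ℝ) m.1 m.2) φ
  refine ⟨K.toNNReal, fun x => ?_⟩
  have h := SchwartzMap.one_add_le_sup_seminorm_apply (𝕜 := ℝ) (m := (N, 0)) (k := N) (n := 0)
    le_rfl le_rfl φ x
  simp only [norm_iteratedFDeriv_zero, Real.norm_eq_abs] at h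
  unfold decay
  rw [← ofReal_norm, show ((K.toNNReal : ℝ≥0) : ℝ≥0∞) = ENNReal.ofReal K from rfl,
    ← ENNReal.ofReal_mul' (by positivity)]
  refine ENNReal.ofReal_le_ofReal ?_
  rw [← div_eq_mul_inv, le_div_iff₀ (by positivity), mul_comm]
  exact h

lemma schwartz_lintegral_growth_lt_top (φ : SchwartzMap ℝ ℂ) (N : ℕ) :
    ∫⁻ x, ‖φ x‖ₑ * growth N x < ⊤ := by
  obtain ⟨C, hC⟩ := schwartz_enorm_le φ (N + 2)
  calc ∫⁻ x, ‖φ x‖ₑ * growth N x ≤ ∫⁻ x, C * decay 2 x := by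
        refine lintegral_mono fun x => ?_
        calc ‖φ x‖ₑ * growth N x ≤ C * decay (N + 2) x * growth N x := by gcongr; exact hC x
          _ = C * decay 2 x * (growth N x * decay N x) := by rw [decay_add]; ring
          _ = _ := by rw [growth_mul_decay, mul_one]
    _ = C * ∫⁻ x, decay 2 x := lintegral_const_mul _ (measurable_decay 2)
    _ < ⊤ := ENNReal.mul_lt_top ENNReal.coe_lt_top (lintegral_decay_lt_top le_rfl)

/-- The character `e(x) = exp(2πix)`. -/
noncomputable def unitChar (x : ℝ) : ℂ := Complex.exp (2 * Real.pi * Complex.I * (x : ℂ))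

lemma unitChar_add (x y : ℝ) : unitChar (x + y) = unitChar x * unitChar y := by
  unfold unitChar; rw [← Complex.exp_add]; congr 1; push_cast; ring

@[simp] lemma norm_unitChar (x : ℝ) : ‖unitChar x‖ = 1 := by
  unfold unitChar
  rw [show (2 * Real.pi * Complex.I * (x : ℂ)) = ((2 * Real.pi * x : ℝ) : ℂ) * Complex.I by
    push_cast; ring, Complex.norm_exp_ofReal_mul_I]

@[simp] lemma enorm_unitChar (x : ℝ) : ‖unitChar x‖ₑ = 1 := by
  rw [← ofReal_norm, norm_unitChar, ENNReal.ofReal_one]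

@[fun_prop]
lemma continuous_unitChar : Continuous unitChar := by unfold unitChar; fun_prop

/-- Schwartz functions are superpositions of characters with a Schwartz density. -/
lemma exists_schwartz_kernel (φ : SchwartzMap ℝ ℂ) :
    ∃ ν : SchwartzMap ℝ ℂ, ∀ x, φ x = ∫ r, ν r * unitChar (r * x) := by
  refine ⟨𝓕 φ, fun x => ?_⟩
  have h : φ x = 𝓕⁻ (𝓕 φ) x := by rw [FourierTransform.fourierInv_fourier_eq]
  rw [h, SchwartzMap.fourierInv_coe, Real.fourierInv_eq']
  refine integral_congr_ae (Filter.Eventually.of_forall fun r => ?_)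
  simp only [smul_eq_mul, unitChar]
  rw [mul_comm]
  congr 2
  simp
  ring

/-- A smooth cutoff function. -/
lemma exists_schwartz_cutoff {a b : ℝ} (ha : 0 < a) (hab : a < b) :
    ∃ (φ : SchwartzMap ℝ ℂ) (f : ℝ → ℝ), (∀ x, φ x = (f x : ℂ)) ∧ (∀ x, 0 ≤ f x) ∧ (∀ x, f x ≤ 1) ∧
      (∀ x, |x| ≤ a → f x = 1) ∧ (∀ x, b ≤ |x| → f x = 0) := by
  let f : ContDiffBump (0 : ℝ) := ⟨a, b, ha, hab⟩
  have hc : HasCompactSupport (fun x => ((f x : ℝ) : ℂ)) :=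
    f.hasCompactSupport.comp_left (g := fun x : ℝ => (x : ℂ)) (by simp)
  have hd : ContDiff ℝ (⊤ : ℕ∞) (fun x => ((f x : ℝ) : ℂ)) :=
    Complex.ofRealCLM.contDiff.comp f.contDiff
  refine ⟨hc.toSchwartzMap hd, f, fun x => rfl, fun x => f.nonneg, fun x => f.le_one,
    fun x hx => ?_, fun x hx => ?_⟩
  · exact f.one_of_mem_closedBall (by simpa using hx)
  · exact f.zero_of_le_dist (by simpa using hx)

/-- The extension operator for the full parabola. -/
noncomputable def parabExt (h : ℝ → ℂ) (y : ℝ × ℝ) : ℂ :=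
  ∫ t, h t * unitChar (t * y.1 + t ^ 2 * y.2)

lemma extOp_eq_parabExt (a b : ℝ) (g : ℝ → ℂ) :
    extOp a b g = parabExt ((Set.Ico a b).indicator g) := by
  funext x
  unfold extOp parabExt
  rw [integral_Icc_eq_integral_Ico, ← integral_indicator measurableSet_Ico]
  refine integral_congr_ae (Filter.Eventually.of_forall fun t => ?_)
  by_cases ht : t ∈ Set.Ico a b <;> simp [ht, unitChar]

lemma norm_parabExt_le (h : ℝ → ℂ) (y : ℝ × ℝ) : ‖parabExt h y‖ ≤ ∫ t, ‖h t‖ := by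
  refine (norm_integral_le_integral_norm _).trans (le_of_eq ?_)
  simp

lemma integrable_mul_unitChar {h : ℝ → ℂ} (hh : Integrable h) {φ : ℝ → ℝ} (hφ : Continuous φ) :
    Integrable fun t => h t * unitChar (φ t) := by
  refine (hh.norm).mono' ?_ (Filter.Eventually.of_forall fun t => by simp)
  exact hh.aestronglyMeasurable.mul (by fun_prop : Continuous fun t => unitChar (φ t)).aestronglyMeasurable

lemma continuous_parabExt {h : ℝ → ℂ} (hh : Integrable h) : Continuous (parabExt h) := by
  unfold parabExt
  refine continuous_of_dominated (bound := fun t => ‖h t‖) (fun y => ?_) (fun y => ?_) hh.norm ?_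
  · exact (integrable_mul_unitChar hh (by fun_prop)).aestronglyMeasurable
  · exact Filter.Eventually.of_forall fun t => by simp
  · exact Filter.Eventually.of_forall fun t => by fun_prop

lemma measurable_enorm_parabExt {h : ℝ → ℂ} (hh : Integrable h) :
    Measurable fun y => ‖parabExt h y‖ₑ :=
  (continuous_parabExt hh).measurable.enorm

lemma parabExt_sum {s : Finset ℕ} {h : ℕ → ℝ → ℂ} (hh : ∀ k ∈ s, Integrable (h k)) (y : ℝ × ℝ) :
    parabExt (fun t => ∑ k ∈ s, h k t) y = ∑ k ∈ s, parabExt (h k) y := by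
  unfold parabExt
  simp_rw [Finset.sum_mul]
  exact integral_finsetSum s fun k hk => integrable_mul_unitChar (hh k hk) (by fun_prop)

lemma parabExt_modulate (h : ℝ → ℂ) (c y : ℝ × ℝ) :
    parabExt (fun t => h t * unitChar (t * c.1 + t ^ 2 * c.2)) y = parabExt h (c + y) := by
  unfold parabExt
  refine integral_congr_ae (Filter.Eventually.of_forall fun t => ?_)
  simp only [mul_assoc, ← unitChar_add, Prod.fst_add, Prod.snd_add]
  congr 2; ring

lemma integral_mul_integral_unitChar {h ν : ℝ → ℂ} (hh : Integrable h) (hν : Integrable ν)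
    {φ : ℝ → ℝ → ℝ} (hφ : Continuous (Function.uncurry φ)) :
    ∫ t, h t * ∫ r, ν r * unitChar (φ t r) = ∫ r, ν r * ∫ t, h t * unitChar (φ t r) := by
  simp_rw [← integral_const_mul]
  rw [integral_integral_swap]
  · refine integral_congr_ae (Filter.Eventually.of_forall fun r => ?_)
    refine integral_congr_ae (Filter.Eventually.of_forall fun t => ?_)
    simp only; ring
  · have h1 : Integrable (fun z : ℝ × ℝ => h z.1 * ν z.2) (volume.prod volume) := hh.mul_prod hν
    refine h1.norm.mono' ?_ (Filter.Eventually.of_forall fun z => ?_)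
    · have h2 : Continuous fun z : ℝ × ℝ => unitChar (Function.uncurry φ z) := by fun_prop
      refine (h1.aestronglyMeasurable.mul h2.aestronglyMeasurable).congr
        (Filter.Eventually.of_forall fun z => ?_)
      simp only [Pi.mul_apply, Function.uncurry]; ring
    · simp [Function.uncurry]

/-- A Fourier multiplier in the frequency variable acts on `parabExt` by averaging translates. -/
lemma enorm_parabExt_multiplier_le {h ν : ℝ → ℂ} (hh : Integrable h) (hν : Integrable ν)
    (A B x s : ℝ) :
    ‖parabExt (fun t => (∫ r, ν r * unitChar (r * (A * t + B))) * h t) (x, s)‖ₑ ≤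
      ∫⁻ r, ‖ν r‖ₑ * ‖parabExt h (x + A * r, s)‖ₑ := by
  have e : parabExt (fun t => (∫ r, ν r * unitChar (r * (A * t + B))) * h t) (x, s) =
      ∫ r, ν r * ∫ t, h t * unitChar (r * (A * t + B) + (t * x + t ^ 2 * s)) := by
    rw [← integral_mul_integral_unitChar hh hν
      (φ := fun t r => r * (A * t + B) + (t * x + t ^ 2 * s)) (by unfold Function.uncurry; fun_prop)]
    unfold parabExt
    refine integral_congr_ae (Filter.Eventually.of_forall fun t => ?_)
    simp only [unitChar_add _ (t * x + t ^ 2 * s), ← mul_assoc]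
    rw [integral_mul_const]; ring
  rw [e]
  refine (enorm_integral_le_lintegral_enorm _).trans (lintegral_mono fun r => ?_)
  rw [enorm_mul]
  gcongr
  have e2 : ∫ t, h t * unitChar (r * (A * t + B) + (t * x + t ^ 2 * s)) =
      unitChar (r * B) * parabExt h (x + A * r, s) := by
    unfold parabExt
    rw [← integral_const_mul]
    refine integral_congr_ae (Filter.Eventually.of_forall fun t => ?_)
    simp only
    rw [show r * (A * t + B) + (t * x + t ^ 2 * s) = r * B + (t * (x + A * r) + t ^ 2 * s) by ring,
      unitChar_add]
    ring
  rw [e2, enorm_mul, enorm_unitChar, one_mul]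

lemma lintegral_translates_rpow_le {p : ℝ} (hp : 1 < p) {a F v c : ℝ → ℝ≥0∞} (ha : Measurable a)
    (hF : Measurable F) (A : ℝ) (hv : Measurable v) (hc : Measurable c) (hc1 : ∀ r, 1 ≤ c r)
    (hvc : ∀ x r, v (x - A * r) ≤ c r * v x) :
    ∫⁻ x, (∫⁻ r, a r * F (x + A * r)) ^ p * v x ≤
      (∫⁻ r, a r * c r) ^ p * ∫⁻ x, F x ^ p * v x := by
  set S := ∫⁻ x, F x ^ p * v x
  calc _ ≤ ∫⁻ x, ((∫⁻ r, a r) ^ (p - 1) * ∫⁻ r, a r * F (x + A * r) ^ p) * v x := by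
        refine lintegral_mono fun x => ?_
        gcongr
        exact lintegral_mul_rpow_le hp ha (by fun_prop)
    _ = (∫⁻ r, a r) ^ (p - 1) * ∫⁻ x, ∫⁻ r, a r * (F (x + A * r) ^ p * v x) := by
        have : Measurable fun z : ℝ × ℝ => a z.2 * (F (z.1 + A * z.2) ^ p * v z.1) := by
          fun_prop
        rw [← lintegral_const_mul _ this.lintegral_prod_right']
        refine lintegral_congr fun x => ?_
        rw [mul_assoc, ← lintegral_mul_const _ (by fun_prop)]
        simp_rw [mul_assoc]
    _ = (∫⁻ r, a r) ^ (p - 1) * ∫⁻ r, a r * ∫⁻ x, F (x + A * r) ^ p * v x := by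
        rw [lintegral_lintegral_swap (by unfold Function.uncurry; fun_prop)]
        congr 1
        refine lintegral_congr fun r => ?_
        rw [lintegral_const_mul _ (by fun_prop)]
    _ ≤ (∫⁻ r, a r) ^ (p - 1) * ∫⁻ r, a r * (c r * S) := by
        gcongr with r
        rw [← lintegral_sub_right_eq_self _ (A * r)]
        simp_rw [sub_add_cancel]
        rw [← lintegral_const_mul _ (by fun_prop)]
        refine lintegral_mono fun x => ?_
        calc _ ≤ F x ^ p * (c r * v x) := by gcongr; exact hvc x r
          _ = _ := by ring
    _ = (∫⁻ r, a r) ^ (p - 1) * (∫⁻ r, a r * c r) * S := by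
        simp_rw [← mul_assoc]
        rw [lintegral_mul_const _ (by fun_prop), mul_assoc]
    _ ≤ (∫⁻ r, a r * c r) ^ (p - 1) * (∫⁻ r, a r * c r) * S := by
        have hp1 : 0 ≤ p - 1 := by linarith
        gcongr with r
        exact le_mul_of_one_le_right zero_le (hc1 r)
    _ = _ := by
        congr 1
        nth_rw 2 [← ENNReal.rpow_one (∫⁻ r, a r * c r)]
        rw [← ENNReal.rpow_add_of_nonneg _ _ (by linarith) (by norm_num), sub_add_cancel]

/-- Weighted `L^p` bound for Fourier multipliers, on horizontal lines. -/
lemma lintegral_parabExt_multiplier_le {p : ℝ} (hp : 1 < p) {h ν : ℝ → ℂ} (hh : Integrable h)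
    (hν : Integrable ν) (hνc : Continuous ν) (A B s : ℝ) {v c : ℝ → ℝ≥0∞} (hv : Measurable v)
    (hc : Measurable c) (hc1 : ∀ r, 1 ≤ c r) (hvc : ∀ x r, v (x - A * r) ≤ c r * v x) :
    ∫⁻ x, ‖parabExt (fun t => (∫ r, ν r * unitChar (r * (A * t + B))) * h t) (x, s)‖ₑ ^ p * v x ≤
      (∫⁻ r, ‖ν r‖ₑ * c r) ^ p * ∫⁻ x, ‖parabExt h (x, s)‖ₑ ^ p * v x := by
  refine le_trans (lintegral_mono fun x => ?_) (lintegral_translates_rpow_le hp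
    (a := fun r => ‖ν r‖ₑ) (F := fun x => ‖parabExt h (x, s)‖ₑ) hνc.measurable.enorm
    ((measurable_enorm_parabExt hh).comp (by fun_prop)) A hv hc hc1 hvc)
  have hp0 : 0 ≤ p := by linarith
  gcongr
  exact enorm_parabExt_multiplier_le hh hν A B x s

lemma wB_nonneg {c : ℝ × ℝ} {R : ℝ} (hR : 0 < R) (x : ℝ × ℝ) : 0 ≤ wB c R x := by
  unfold wB; positivity

lemma wB_eq (c : ℝ × ℝ) (R : ℝ) (x : ℝ × ℝ) :
    wB c R x = ((1 + Real.sqrt ((x.1 - c.1) ^ 2 + (x.2 - c.2) ^ 2) / R) ^ 100)⁻¹ := by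
  unfold wB
  rw [show (-100 : ℤ) = -((100 : ℕ) : ℤ) from rfl, zpow_neg, zpow_natCast]

lemma measurable_wB (c : ℝ × ℝ) (R : ℝ) : Measurable (wB c R) := by
  rw [funext (wB_eq c R)]
  fun_prop

lemma integrable_wB (c : ℝ × ℝ) {R : ℝ} (hR : 0 < R) : Integrable (wB c R) := by
  have h := integrable_one_add_norm (E := ℝ × ℝ) (μ := volume) (r := 100) (by simp; norm_num)
  have h2 := (h.comp_smul (R := R⁻¹) (by positivity)).comp_sub_right c
  refine h2.mono' (measurable_wB c R).aestronglyMeasurable (Filter.Eventually.of_forall fun x => ?_)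
  rw [Real.norm_of_nonneg (wB_nonneg hR x), wB_eq, Real.rpow_neg (by positivity),
    show (100 : ℝ) = ((100 : ℕ) : ℝ) by norm_num, Real.rpow_natCast]
  gcongr
  rw [norm_smul, Real.norm_of_nonneg (by positivity : 0 ≤ R⁻¹), inv_mul_eq_div]
  gcongr
  rw [Prod.norm_def]
  refine max_le ?_ ?_ <;> refine Real.abs_le_sqrt ?_
  · simp; positivity
  · simp; positivity

lemma ofReal_norm_rpow {p : ℝ} (hp : 0 < p) (z : ℂ) : ENNReal.ofReal (‖z‖ ^ p) = ‖z‖ₑ ^ p := by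
  rw [← ENNReal.ofReal_rpow_of_nonneg (norm_nonneg z) hp.le, ofReal_norm]

lemma integrable_norm_rpow_mul {p : ℝ} (hp : 0 < p) {h : ℝ → ℂ} (hh : Integrable h)
    {w : ℝ × ℝ → ℝ} {μ : Measure (ℝ × ℝ)} (hw : Integrable w μ) :
    Integrable (fun y => ‖parabExt h y‖ ^ p * w y) μ := by
  refine hw.bdd_mul (c := (∫ t, ‖h t‖) ^ p)
    ((continuous_parabExt hh).norm.rpow_const fun _ => Or.inr hp.le).aestronglyMeasurable
    (Filter.Eventually.of_forall fun y => ?_)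
  rw [Real.norm_of_nonneg (by positivity)]
  gcongr
  exact norm_parabExt_le h y

lemma ofReal_wLp {p : ℝ} (hp : 0 < p) {h : ℝ → ℂ} (hh : Integrable h) (c : ℝ × ℝ) {R : ℝ}
    (hR : 0 < R) : ENNReal.ofReal (wLp p (wB c R) (parabExt h)) =
      (∫⁻ y, ‖parabExt h y‖ₑ ^ p * ENNReal.ofReal (wB c R y)) ^ (1 / p) := by
  have hw := wB_nonneg (c := c) hR
  unfold wLp
  rw [← ENNReal.ofReal_rpow_of_nonneg (integral_nonneg fun y => mul_nonneg (by positivity) (hw y))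
    (by positivity), ofReal_integral_eq_lintegral_ofReal
    (integrable_norm_rpow_mul hp hh (integrable_wB c hR))
    (Filter.Eventually.of_forall fun y => mul_nonneg (by positivity) (hw y))]
  simp_rw [ENNReal.ofReal_mul' (hw _), ofReal_norm_rpow hp]

lemma volume_sqr_lt_top (c : ℝ × ℝ) (R : ℝ) : volume (sqr c R) < ⊤ :=
  (isCompact_Icc.prod isCompact_Icc).measure_lt_top

lemma measurableSet_sqr (c : ℝ × ℝ) (R : ℝ) : MeasurableSet (sqr c R) :=
  measurableSet_Icc.prod measurableSet_Icc

lemma ofReal_sqLp {p : ℝ} (hp : 0 < p) {h : ℝ → ℂ} (hh : Integrable h) (c : ℝ × ℝ) (R : ℝ) :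
    ENNReal.ofReal (sqLp p c R (parabExt h)) =
      (∫⁻ y in sqr c R, ‖parabExt h y‖ₑ ^ p) ^ (1 / p) := by
  have hi : Integrable (fun y => ‖parabExt h y‖ ^ p) (volume.restrict (sqr c R)) := by
    have := integrable_norm_rpow_mul hp hh (w := fun _ => 1) (μ := volume.restrict (sqr c R))
      (integrableOn_const (volume_sqr_lt_top c R).ne)
    simpa using this
  unfold sqLp
  rw [← ENNReal.ofReal_rpow_of_nonneg (integral_nonneg fun y => by positivity)
    (by positivity), ofReal_integral_eq_lintegral_ofReal hi
    (Filter.Eventually.of_forall fun y => by positivity)]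
  simp_rw [ofReal_norm_rpow hp]

/-- The decoupling inequality in terms of lower Lebesgue integrals. -/
lemma sqLp_le_iff {p : ℝ} (hp : 0 < p) {g : ℝ → ℂ} (hg : Integrable g) {m : ℕ} {h : ℕ → ℝ → ℂ}
    (hh : ∀ k < m, Integrable (h k)) (c : ℝ × ℝ) {R : ℝ} (hR : 0 < R) {D : ℝ} (hD : 0 ≤ D) :
    sqLp p c R (parabExt g) ≤
        D * (∑ k ∈ Finset.range m, wLp p (wB c R) (parabExt (h k)) ^ 2) ^ (1 / 2 : ℝ) ↔
      ∫⁻ y in sqr c R, ‖parabExt g y‖ₑ ^ p ≤ ENNReal.ofReal D ^ p *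
        lpSq p m (fun k => ∫⁻ y, ‖parabExt (h k) y‖ₑ ^ p * ENNReal.ofReal (wB c R y)) := by
  have hw : ∀ f, 0 ≤ wLp p (wB c R) f := fun f => by
    unfold wLp
    exact Real.rpow_nonneg (integral_nonneg fun y => mul_nonneg (by positivity) (wB_nonneg hR y)) _
  rw [← ENNReal.ofReal_le_ofReal_iff (by positivity), ofReal_sqLp hp hg, ENNReal.ofReal_mul hD,
    ← ENNReal.ofReal_rpow_of_nonneg (by positivity) (by norm_num),
    ENNReal.ofReal_sum_of_nonneg (fun k _ => by positivity), one_div p,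
    ENNReal.rpow_inv_le_iff hp, ENNReal.mul_rpow_of_nonneg _ _ hp.le, ← ENNReal.rpow_mul]
  unfold lpSq
  rw [show 1 / 2 * p = p / 2 by ring]
  have : ∀ k ∈ Finset.range m, ENNReal.ofReal (wLp p (wB c R) (parabExt (h k)) ^ 2) =
      (∫⁻ y, ‖parabExt (h k) y‖ₑ ^ p * ENNReal.ofReal (wB c R y)) ^ (2 / p) := by
    intro k hk
    rw [ENNReal.ofReal_pow (hw _), ofReal_wLp hp (hh k (Finset.mem_range.1 hk)) c hR,
      ← ENNReal.rpow_natCast, ← ENNReal.rpow_mul]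
    congr 1; push_cast; ring
  rw [Finset.sum_congr rfl this]

lemma indicator_Ico_eq_sum {n : ℝ} (hn : 0 < n) (u : ℝ) (m : ℕ) (g : ℝ → ℂ) (t : ℝ) :
    (Set.Ico u (u + m / n)).indicator g t =
      ∑ k ∈ Finset.range m, (Set.Ico (u + k / n) (u + ((k : ℝ) + 1) / n)).indicator g t := by
  induction m with
  | zero => simp
  | succ m ih =>
    rw [Finset.sum_range_succ, ← ih]
    have h1 : u ≤ u + m / n := by linarith [show 0 ≤ (m : ℝ) / n by positivity]
    have h2 : u + m / n ≤ u + ((m : ℝ) + 1) / n := by gcongr; linarith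
    rw [Nat.cast_succ, ← Set.Ico_union_Ico_eq_Ico h1 h2, Set.indicator_union_of_disjoint]
    exact Set.Ico_disjoint_Ico_same

lemma integrable_indicator_Ico {g : ℝ → ℂ} (hg : IntegrableOn g (Set.Icc 0 1)) {a b : ℝ}
    (ha : 0 ≤ a) (hb : b ≤ 1) : Integrable ((Set.Ico a b).indicator g) :=
  (integrable_indicator_iff measurableSet_Ico).2
    (hg.mono_set ((Set.Ico_subset_Ico ha hb).trans Set.Ico_subset_Icc_self))

lemma piece_mem {m k : ℕ} (hk : k < m) : 0 ≤ (k : ℝ) / m ∧ ((k : ℝ) + 1) / m ≤ 1 := by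
  have : (k : ℝ) + 1 ≤ m := by exact_mod_cast hk
  refine ⟨by positivity, ?_⟩
  rw [div_le_one (by linarith [Nat.cast_nonneg (α := ℝ) k])]
  exact this

lemma decIneq_iff {p : ℝ} (hp : 0 < p) {m : ℕ} (hm : 0 < m) {D : ℝ} (hD : 0 ≤ D) :
    DecIneq p m D ↔ ∀ g : ℝ → ℂ, IntegrableOn g (Set.Icc 0 1) → ∀ c : ℝ × ℝ,
      ∫⁻ y in sqr c ((m : ℝ) ^ 2), ‖parabExt ((Set.Ico 0 1).indicator g) y‖ₑ ^ p ≤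
        ENNReal.ofReal D ^ p * lpSq p m (fun k => ∫⁻ y,
          ‖parabExt ((Set.Ico ((k : ℝ) / m) (((k : ℝ) + 1) / m)).indicator g) y‖ₑ ^ p *
            ENNReal.ofReal (wB c ((m : ℝ) ^ 2) y)) := by
  unfold DecIneq
  refine forall_congr' fun g => forall_congr' fun hg => forall_congr' fun c => ?_
  simp_rw [extOp_eq_parabExt]
  exact sqLp_le_iff hp (integrable_indicator_Ico hg le_rfl le_rfl)
    (h := fun k => (Set.Ico ((k : ℝ) / m) (((k : ℝ) + 1) / m)).indicator g)
    (fun k hk => integrable_indicator_Ico hg (piece_mem hk).1 (piece_mem hk).2) c (by positivity) hD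

lemma one_le_mul_wB {c : ℝ × ℝ} {R : ℝ} (hR : 0 < R) {y : ℝ × ℝ} (hy : y ∈ sqr c R) :
    1 ≤ (2 : ℝ≥0∞) ^ 100 * ENNReal.ofReal (wB c R y) := by
  rw [wB_eq]
  obtain ⟨⟨h1, h2⟩, h3, h4⟩ := hy
  have h5 : Real.sqrt ((y.1 - c.1) ^ 2 + (y.2 - c.2) ^ 2) ≤ R := by
    rw [Real.sqrt_le_left hR.le]
    nlinarith
  have h6 : Real.sqrt ((y.1 - c.1) ^ 2 + (y.2 - c.2) ^ 2) / R ≤ 1 := by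
    rwa [div_le_one hR]
  rw [show (2 : ℝ≥0∞) ^ 100 = ENNReal.ofReal (2 ^ 100) by
    rw [ENNReal.ofReal_pow (by norm_num)]; norm_num, ← ENNReal.ofReal_mul (by positivity),
    ENNReal.one_le_ofReal, ← div_eq_mul_inv, one_le_div (by positivity)]
  gcongr
  linarith

lemma exists_decIneq {p : ℝ} (hp : 1 ≤ p) {m : ℕ} (hm : 0 < m) : ∃ D : ℝ, 0 ≤ D ∧ DecIneq p m D := by
  have hp0 : 0 < p := by linarith
  set K : ℝ≥0∞ := (m : ℝ≥0∞) ^ (p - 1) * (m * 2 ^ 100)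
  have hK : K ≠ ⊤ := by
    refine ENNReal.mul_ne_top (ENNReal.rpow_ne_top_of_nonneg (by linarith) (by simp)) ?_
    exact ENNReal.mul_ne_top (by simp) (by simp)
  refine ⟨(K ^ (1 / p)).toReal, ENNReal.toReal_nonneg, ?_⟩
  rw [decIneq_iff hp0 hm ENNReal.toReal_nonneg]
  intro g hg c
  have hR : (0 : ℝ) < (m : ℝ) ^ 2 := by positivity
  set h : ℕ → ℝ → ℂ := fun k => (Set.Ico ((k : ℝ) / m) (((k : ℝ) + 1) / m)).indicator g
  have hh : ∀ k ∈ Finset.range m, Integrable (h k) := fun k hk =>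
    integrable_indicator_Ico hg (piece_mem (Finset.mem_range.1 hk)).1
      (piece_mem (Finset.mem_range.1 hk)).2
  set A : ℕ → ℝ≥0∞ := fun k => ∫⁻ y, ‖parabExt (h k) y‖ₑ ^ p *
    ENNReal.ofReal (wB c ((m : ℝ) ^ 2) y)
  have hsum : (Set.Ico (0 : ℝ) 1).indicator g = fun t => ∑ k ∈ Finset.range m, h k t := by
    funext t
    have := indicator_Ico_eq_sum (n := m) (by positivity) 0 m g t
    simpa [div_self (show (m : ℝ) ≠ 0 by positivity)] using this
  rw [ENNReal.ofReal_toReal (ENNReal.rpow_ne_top_of_nonneg (by positivity) hK), ← ENNReal.rpow_mul,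
    one_div_mul_cancel hp0.ne', ENNReal.rpow_one, hsum]
  have hmeas : ∀ k ∈ Finset.range m, Measurable fun y => ‖parabExt (h k) y‖ₑ ^ p := fun k hk =>
    (measurable_enorm_parabExt (hh k hk)).pow_const p
  calc ∫⁻ y in sqr c ((m : ℝ) ^ 2), ‖parabExt (fun t => ∑ k ∈ Finset.range m, h k t) y‖ₑ ^ p
      ≤ ∫⁻ y in sqr c ((m : ℝ) ^ 2), (m : ℝ≥0∞) ^ (p - 1) *
          ∑ k ∈ Finset.range m, ‖parabExt (h k) y‖ₑ ^ p := by
        refine lintegral_mono fun y => ?_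
        rw [parabExt_sum hh]
        refine (ENNReal.rpow_le_rpow (enorm_sum_le _ _) hp0.le).trans ?_
        have := ENNReal.rpow_sum_le_const_mul_sum_rpow (Finset.range m)
          (fun k => ‖parabExt (h k) y‖ₑ) hp
        simpa using this
    _ = (m : ℝ≥0∞) ^ (p - 1) * ∑ k ∈ Finset.range m,
          ∫⁻ y in sqr c ((m : ℝ) ^ 2), ‖parabExt (h k) y‖ₑ ^ p := by
        rw [lintegral_const_mul _ (Finset.measurable_fun_sum _ hmeas), lintegral_finsetSum' _
          fun k hk => (hmeas k hk).aemeasurable]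
    _ ≤ (m : ℝ≥0∞) ^ (p - 1) * ∑ k ∈ Finset.range m, 2 ^ 100 * lpSq p m A := by
        gcongr with k hk
        calc ∫⁻ y in sqr c ((m : ℝ) ^ 2), ‖parabExt (h k) y‖ₑ ^ p
            ≤ ∫⁻ y in sqr c ((m : ℝ) ^ 2), 2 ^ 100 *
                (‖parabExt (h k) y‖ₑ ^ p * ENNReal.ofReal (wB c ((m : ℝ) ^ 2) y)) := by
              refine setLIntegral_mono' (measurableSet_sqr _ _) fun y hy => ?_
              rw [mul_left_comm]
              exact le_mul_of_one_le_right zero_le (one_le_mul_wB hR hy)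
          _ ≤ ∫⁻ y, 2 ^ 100 *
                (‖parabExt (h k) y‖ₑ ^ p * ENNReal.ofReal (wB c ((m : ℝ) ^ 2) y)) :=
              setLIntegral_le_lintegral _ _
          _ = 2 ^ 100 * A k := lintegral_const_mul _
              ((hmeas k hk).mul (measurable_wB _ _).ennreal_ofReal)
          _ ≤ _ := by gcongr; exact le_lpSq hp0 (Finset.mem_range.1 hk) A
    _ = K * lpSq p m A := by
        rw [Finset.sum_const, Finset.card_range, nsmul_eq_mul]
        simp only [K]; ring

lemma Dconst_nonneg (p : ℝ) (m : ℕ) : 0 ≤ Dconst p m := Real.sInf_nonneg fun _ h => h.1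

/-- The infimum defining the decoupling constant is attained. -/
lemma decIneq_Dconst {p : ℝ} (hp : 1 ≤ p) {m : ℕ} (hm : 0 < m) : DecIneq p m (Dconst p m) := by
  intro g hg c
  set S := (∑ k ∈ Finset.range m, wLp p (wB c ((m : ℝ) ^ 2))
    (extOp ((k : ℝ) / (m : ℝ)) (((k : ℝ) + 1) / (m : ℝ)) g) ^ 2) ^ (1 / 2 : ℝ)
  have hS : 0 ≤ S := by positivity
  refine le_of_forall_pos_le_add fun ε hε => ?_
  obtain ⟨D', hD', hlt⟩ := Real.lt_sInf_add_pos (s := {D : ℝ | 0 ≤ D ∧ DecIneq p m D})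
    (exists_decIneq hp hm) (show 0 < ε / (S + 1) by positivity)
  calc _ ≤ D' * S := hD'.2 g hg c
    _ ≤ (Dconst p m + ε / (S + 1)) * S := by
        gcongr
        exact hlt.le
    _ = Dconst p m * S + ε * (S / (S + 1)) := by ring
    _ ≤ _ := by
        have : S / (S + 1) ≤ 1 := by rw [div_le_one (by positivity)]; linarith
        nlinarith

/-- A complex Gaussian `exp (-π (1 - 2 i b) θ²)` is a superposition of characters whose density has
`L¹` norm at most `1 + 2 |b|`. -/
lemma exists_gaussian_kernel (b : ℝ) : ∃ ν : ℝ → ℂ, Integrable ν ∧ Continuous ν ∧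
    (∀ θ : ℝ, Complex.exp (-Real.pi * θ ^ 2) * unitChar (b * θ ^ 2) =
      ∫ r, ν r * unitChar (r * θ)) ∧
    ∫⁻ r, ‖ν r‖ₑ ≤ growth 1 (2 * b) := by
  set w : ℂ := 1 - 2 * b * Complex.I with hw
  have hre : w.re = 1 := by simp [hw]
  have him : w.im = -(2 * b) := by simp [hw]
  have hw0 : w ≠ 0 := fun h => by simp [h] at hre
  have hpi := Real.pi_pos
  have hpi' : (Real.pi : ℂ) ≠ 0 := by exact_mod_cast hpi.ne'
  set a : ℂ := Real.pi / w with ha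
  have hns : Complex.normSq w = ‖w‖ ^ 2 := Complex.normSq_eq_norm_sq w
  have hN : 0 < ‖w‖ := norm_pos_iff.2 hw0
  have hare : a.re = Real.pi / ‖w‖ ^ 2 := by
    rw [ha, Complex.div_re, hre, hns]; simp
  have hapos : 0 < a.re := by rw [hare]; positivity
  set s : ℂ := w ^ ((1 / 2 : ℝ) : ℂ) with hs
  have hsn : ‖s‖ = ‖w‖ ^ (1 / 2 : ℝ) := Complex.norm_cpow_real w _
  have hs0 : s ≠ 0 := by
    rw [← norm_pos_iff, hsn]; positivity
  have hgi : Integrable fun r : ℝ => s⁻¹ * Complex.exp (-a * r ^ 2) :=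
    (integrable_cexp_neg_mul_sq hapos).const_mul _
  refine ⟨fun r => s⁻¹ * Complex.exp (-a * r ^ 2), hgi, by fun_prop, fun θ => ?_, ?_⟩
  · have h := fourierIntegral_gaussian hapos (2 * Real.pi * θ : ℂ)
    have e1 : (Real.pi / a : ℂ) ^ (1 / 2 : ℂ) = s := by
      rw [hs, ha, div_div_cancel₀ hpi']; norm_num
    have e2 : -(2 * Real.pi * θ : ℂ) ^ 2 / (4 * a) = -Real.pi * θ ^ 2 +
        2 * Real.pi * Complex.I * ((b * θ ^ 2 : ℝ) : ℂ) := by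
      rw [ha]; field_simp; rw [hw]; push_cast; ring
    rw [e1, e2, Complex.exp_add] at h
    calc _ = s⁻¹ * (s * (Complex.exp (-Real.pi * θ ^ 2) * unitChar (b * θ ^ 2))) := by
          field_simp
      _ = _ := by
          unfold unitChar
          rw [← h, ← integral_const_mul]
          refine integral_congr_ae (Filter.Eventually.of_forall fun r => ?_)
          have : Complex.I * (2 * Real.pi * θ) * r = 2 * Real.pi * Complex.I * ((r * θ : ℝ) : ℂ) := by
            push_cast; ring
          simp only [this]; ring
  · have e : ∀ r : ℝ, ‖s⁻¹ * Complex.exp (-a * r ^ 2)‖ = ‖s‖⁻¹ * Real.exp (-a.re * r ^ 2) := by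
      intro r; rw [norm_mul, norm_inv, norm_cexp_neg_mul_sq]
    have : ∫ r : ℝ, ‖s⁻¹ * Complex.exp (-a * r ^ 2)‖ = ‖w‖ ^ (1 / 2 : ℝ) := by
      simp_rw [e]
      rw [integral_const_mul, integral_gaussian, hsn, hare, div_div_cancel₀ hpi.ne',
        Real.sqrt_sq hN.le]
      rw [← Real.rpow_neg hN.le, ← Real.rpow_add_one hN.ne']; norm_num
    rw [← ofReal_integral_norm_eq_lintegral_enorm hgi, this]
    unfold growth
    refine ENNReal.ofReal_le_ofReal ?_
    have h1 : ‖w‖ ≤ 1 + |2 * b| := by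
      refine (Complex.norm_le_abs_re_add_abs_im w).trans ?_
      rw [hre, him, abs_neg]; simp
    calc ‖w‖ ^ (1 / 2 : ℝ) ≤ (1 + |2 * b|) ^ (1 / 2 : ℝ) := by gcongr
      _ ≤ (1 + |2 * b|) ^ (1 : ℝ) :=
        Real.rpow_le_rpow_of_exponent_le (by linarith [abs_nonneg (2 * b)]) (by norm_num)
      _ = (1 + |2 * b|) ^ 1 := by norm_num

/-- Evolving the extension of a function supported on an interval of length about `1 / A` by a
time `b A²` costs at most a power of `1 + |b|` in `L^p` of a horizontal line. -/
lemma exists_lintegral_parabExt_evolve_le : ∃ C : ℝ≥0, 1 ≤ C ∧ ∀ p : ℝ, 1 < p → ∀ A B : ℝ, 0 < A →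
    ∀ H : ℝ → ℂ, Integrable H → (∀ t, H t ≠ 0 → |A * t + B| ≤ 1) → ∀ s τ : ℝ,
      ∫⁻ x, ‖parabExt H (x, s)‖ₑ ^ p ≤
        (C * growth 1 (2 * ((s - τ) / A ^ 2))) ^ p * ∫⁻ x, ‖parabExt H (x, τ)‖ₑ ^ p := by
  obtain ⟨φ, f, hφf, -, -, hf1, hf0⟩ := exists_schwartz_cutoff (a := 1) (b := 2) one_pos (by norm_num)
  have hcs : HasCompactSupport fun θ : ℝ => φ θ * Complex.exp (Real.pi * θ ^ 2) := by
    refine HasCompactSupport.of_support_subset_isCompact (isCompact_Icc (a := (-2 : ℝ)) (b := 2))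
      fun x hx => ?_
    by_contra h
    apply hx
    have : 2 ≤ |x| := by
      by_contra h2
      exact h (abs_le.1 (not_le.1 h2).le)
    simp [hφf, hf0 x this]
  have hcd : ContDiff ℝ (⊤ : ℕ∞) fun θ : ℝ => φ θ * Complex.exp (Real.pi * θ ^ 2) := by
    refine (φ.smooth _).mul ?_
    have : ContDiff ℝ (⊤ : ℕ∞) fun θ : ℝ => (θ : ℂ) := Complex.ofRealCLM.contDiff
    fun_prop
  obtain ⟨κ, hκ⟩ := exists_schwartz_kernel (hcs.toSchwartzMap hcd)
  have hκ' : ∀ θ : ℝ, φ θ * Complex.exp (Real.pi * θ ^ 2) = ∫ r, κ r * unitChar (r * θ) := hκ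
  have hfin : ∫⁻ r, ‖κ r‖ₑ < ⊤ := κ.integrable.2
  refine ⟨max 1 (∫⁻ r, ‖κ r‖ₑ).toNNReal, le_max_left _ _, ?_⟩
  intro p hp A B hA H hH hsupp s τ
  have hp0 : 0 ≤ p := by linarith
  set b := (s - τ) / A ^ 2 with hb
  obtain ⟨ν, hνi, hνc, hν, hνn⟩ := exists_gaussian_kernel b
  set H1 : ℝ → ℂ := fun t => (∫ r, κ r * unitChar (r * (A * t + B))) * H t with hH1
  set H2 : ℝ → ℂ := fun t => (∫ r, ν r * unitChar (r * (A * t + B))) * H1 t with hH2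
  have key : ∀ t, H2 t = unitChar (b * (A * t + B) ^ 2) * H t := by
    intro t
    by_cases h : H t = 0
    · simp [hH2, hH1, h]
    · have h1 := hf1 _ (hsupp t h)
      simp only [hH2, hH1]
      rw [← hκ', ← hν, hφf, h1, Complex.ofReal_one]
      have : Complex.exp (-Real.pi * ((A * t + B : ℝ) : ℂ) ^ 2) *
          Complex.exp (Real.pi * ((A * t + B : ℝ) : ℂ) ^ 2) = 1 := by
        rw [← Complex.exp_add]; simp
      linear_combination (unitChar (b * (A * t + B) ^ 2) * H t) * this
  have hH1e : ∀ t, H1 t = (φ (A * t + B) * Complex.exp (Real.pi * (A * t + B : ℝ) ^ 2)) * H t := by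
    intro t; simp only [hH1]; rw [← hκ']
  have hH1i : Integrable H1 := by
    have hcont : Continuous fun t : ℝ => φ (A * t + B) * Complex.exp (Real.pi * (A * t + B : ℝ) ^ 2) :=
      (φ.continuous.comp (by fun_prop)).mul (by fun_prop)
    refine (hH.norm.const_mul (Real.exp Real.pi)).mono'
      ((hcont.aestronglyMeasurable.mul hH.aestronglyMeasurable).congr
        (Filter.Eventually.of_forall fun t => (hH1e t).symm)) (Filter.Eventually.of_forall fun t => ?_)
    by_cases h : H t = 0
    · simp [hH1, h]
    · have h0 := hsupp t h
      have h1 := hf1 _ h0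
      rw [hH1e, norm_mul, hφf, h1]
      gcongr
      rw [← Complex.ofReal_pow, ← Complex.ofReal_mul, ← Complex.ofReal_exp]
      simp only [Complex.ofReal_one, one_mul, Complex.norm_real, Real.norm_eq_abs, Real.abs_exp]
      refine Real.exp_le_exp.2 ?_
      have : (A * t + B) ^ 2 ≤ 1 := by rw [sq_le_one_iff_abs_le_one]; exact h0
      nlinarith [Real.pi_pos]
  have hshift : ∀ x, ‖parabExt H (x, s)‖ₑ = ‖parabExt H2 (x - 2 * b * B * A, τ)‖ₑ := by
    intro x
    have e : parabExt H (x, s) = unitChar (-(b * B ^ 2)) * parabExt H2 (x - 2 * b * B * A, τ) := by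
      unfold parabExt
      rw [← integral_const_mul]
      refine integral_congr_ae (Filter.Eventually.of_forall fun t => ?_)
      simp only [key]
      have e2 : t * x + t ^ 2 * s = -(b * B ^ 2) + (b * (A * t + B) ^ 2 +
          (t * (x - 2 * b * B * A) + t ^ 2 * τ)) := by
        rw [hb]; field_simp; ring
      rw [e2, unitChar_add, unitChar_add]; ring
    rw [e, enorm_mul, enorm_unitChar, one_mul]
  calc ∫⁻ x, ‖parabExt H (x, s)‖ₑ ^ p = ∫⁻ x, ‖parabExt H2 (x, τ)‖ₑ ^ p := by
        simp_rw [hshift]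
        exact lintegral_sub_right_eq_self (μ := volume) (fun x => ‖parabExt H2 (x, τ)‖ₑ ^ p) _
    _ ≤ (∫⁻ r, ‖ν r‖ₑ) ^ p * ∫⁻ x, ‖parabExt H1 (x, τ)‖ₑ ^ p := by
        simpa using lintegral_parabExt_multiplier_le hp hH1i hνi hνc A B τ (v := fun _ => 1)
          (c := fun _ => 1) (by fun_prop) (by fun_prop) (by simp) (by simp)
    _ ≤ (∫⁻ r, ‖ν r‖ₑ) ^ p * ((∫⁻ r, ‖κ r‖ₑ) ^ p * ∫⁻ x, ‖parabExt H (x, τ)‖ₑ ^ p) := by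
        gcongr
        simpa using lintegral_parabExt_multiplier_le hp hH κ.integrable κ.continuous A B τ
          (v := fun _ => 1) (c := fun _ => 1) (by fun_prop) (by fun_prop) (by simp) (by simp)
    _ = ((∫⁻ r, ‖κ r‖ₑ) * ∫⁻ r, ‖ν r‖ₑ) ^ p * ∫⁻ x, ‖parabExt H (x, τ)‖ₑ ^ p := by
        rw [ENNReal.mul_rpow_of_nonneg _ _ hp0]; ring
    _ ≤ _ := by
        gcongr
        rw [ENNReal.coe_max, ENNReal.coe_toNNReal hfin.ne]
        exact le_max_right _ _

/-- The inverse Fourier transform of a Schwartz function is Schwartz. -/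
lemma exists_schwartz_transform (φ : SchwartzMap ℝ ℂ) :
    ∃ ψ : SchwartzMap ℝ ℂ, ∀ x, ψ x = ∫ r, φ r * unitChar (r * x) := by
  refine ⟨𝓕⁻ φ, fun x => ?_⟩
  rw [SchwartzMap.fourierInv_coe, Real.fourierInv_eq']
  refine integral_congr_ae (Filter.Eventually.of_forall fun r => ?_)
  simp only [smul_eq_mul, unitChar]
  rw [mul_comm]
  congr 2
  simp; ring

/-- The convolution of `h(t) e(t² τ)` with `b`, multiplied by `e(-t² τ)`. -/
noncomputable def mollify (b h : ℝ → ℂ) (τ t : ℝ) : ℂ :=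
  ∫ l, b l * (h (t - l) * unitChar (((t - l) ^ 2 - t ^ 2) * τ))

lemma mollify_congr {b h h' : ℝ → ℂ} {τ t : ℝ} (hb : ∀ l, b l ≠ 0 → h (t - l) = h' (t - l)) :
    mollify b h τ t = mollify b h' τ t := by
  unfold mollify
  refine integral_congr_ae (Filter.Eventually.of_forall fun l => ?_)
  by_cases hl : b l = 0
  · simp [hl]
  · simp [hb l hl]

lemma mollify_zero (b : ℝ → ℂ) (τ t : ℝ) : mollify b (fun _ => 0) τ t = 0 := by
  simp [mollify]

lemma integrable_mollify_integrand {b h : ℝ → ℂ} (hb : Integrable b) (hh : Integrable h)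
    {φ : ℝ × ℝ → ℝ} (hφ : Continuous φ) :
    Integrable (fun z : ℝ × ℝ => b z.2 * (h (z.1 - z.2) * unitChar (φ z))) (volume.prod volume) := by
  have h1 := Integrable.convolution_integrand (ContinuousLinearMap.mul ℂ ℂ) hb hh
    (μ := volume) (ν := volume)
  refine h1.norm.mono' ?_ (Filter.Eventually.of_forall fun z => by simp)
  refine (h1.aestronglyMeasurable.mul (g := fun z : ℝ × ℝ => unitChar (φ z))
    (by fun_prop : Continuous fun z : ℝ × ℝ => unitChar (φ z)).aestronglyMeasurable).congr
    (Filter.Eventually.of_forall fun z => ?_)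
  simp [mul_assoc]

lemma integrable_mollify {b h : ℝ → ℂ} (hb : Integrable b) (hh : Integrable h) (τ : ℝ) :
    Integrable (mollify b h τ) :=
  (integrable_mollify_integrand hb hh (φ := fun z => ((z.1 - z.2) ^ 2 - z.1 ^ 2) * τ)
    (by fun_prop)).integral_prod_left

/-- Superpositions of characters against an integrable density, at phase `φ`. -/
noncomputable def phaseInt (h : ℝ → ℂ) (a b c : ℝ) : ℂ :=
  ∫ t, h t * unitChar (a * t + b * t ^ 2 + c)

lemma norm_phaseInt_le (h : ℝ → ℂ) (a b c : ℝ) : ‖phaseInt h a b c‖ ≤ ∫ t, ‖h t‖ := by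
  refine (norm_integral_le_integral_norm _).trans (le_of_eq ?_)
  simp

lemma continuous_phaseInt {h : ℝ → ℂ} (hh : Integrable h) :
    Continuous fun z : ℝ × ℝ × ℝ => phaseInt h z.1 z.2.1 z.2.2 := by
  unfold phaseInt
  refine continuous_of_dominated (bound := fun t => ‖h t‖) (fun y => ?_) (fun y => ?_) hh.norm ?_
  · exact (integrable_mul_unitChar hh (by fun_prop)).aestronglyMeasurable
  · exact Filter.Eventually.of_forall fun t => by simp
  · exact Filter.Eventually.of_forall fun t => by fun_prop

/-- The phase integral occurring inside the extension of a mollified function. -/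
noncomputable def mollPhase (h : ℝ → ℂ) (τ : ℝ) (y : ℝ × ℝ) (l : ℝ) : ℂ :=
  phaseInt h (y.1 + 2 * l * (y.2 - τ)) y.2 (l * y.1 + l ^ 2 * (y.2 - τ))

lemma continuous_mollPhase {h : ℝ → ℂ} (hh : Integrable h) :
    Continuous fun z : (ℝ × ℝ × ℝ) × ℝ => mollPhase h z.1.1 z.1.2 z.2 := by
  unfold mollPhase
  exact (continuous_phaseInt hh).comp (f := fun z : (ℝ × ℝ × ℝ) × ℝ =>
    (z.1.2.1 + 2 * z.2 * (z.1.2.2 - z.1.1), z.1.2.2, z.2 * z.1.2.1 + z.2 ^ 2 * (z.1.2.2 - z.1.1)))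
    (by fun_prop)

lemma parabExt_mollify {b h : ℝ → ℂ} (hb : Integrable b) (hh : Integrable h) (τ : ℝ) (y : ℝ × ℝ) :
    parabExt (mollify b h τ) y = ∫ l, b l * mollPhase h τ y l := by
  have hi := integrable_mollify_integrand hb hh
    (φ := fun z => ((z.1 - z.2) ^ 2 - z.1 ^ 2) * τ + (z.1 * y.1 + z.1 ^ 2 * y.2)) (by fun_prop)
  calc parabExt (mollify b h τ) y = ∫ t, ∫ l, b l * (h (t - l) *
        unitChar (((t - l) ^ 2 - t ^ 2) * τ + (t * y.1 + t ^ 2 * y.2))) := by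
        unfold parabExt mollify
        refine integral_congr_ae (Filter.Eventually.of_forall fun t => ?_)
        simp only
        rw [← integral_mul_const]
        refine integral_congr_ae (Filter.Eventually.of_forall fun l => ?_)
        simp only [unitChar_add (((t - l) ^ 2 - t ^ 2) * τ)]; ring
    _ = ∫ l, ∫ t, b l * (h (t - l) *
        unitChar (((t - l) ^ 2 - t ^ 2) * τ + (t * y.1 + t ^ 2 * y.2))) :=
        integral_integral_swap hi
    _ = _ := by
        refine integral_congr_ae (Filter.Eventually.of_forall fun l => ?_)
        simp only [mollPhase, phaseInt]
        rw [integral_const_mul, ← integral_add_right_eq_self _ l]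
        congr 1
        refine integral_congr_ae (Filter.Eventually.of_forall fun t => ?_)
        simp only [add_sub_cancel_right]
        congr 2; ring

lemma continuous_parabExt_mollify {b h : ℝ → ℂ} (hb : Integrable b) (hh : Integrable h) :
    Continuous fun z : ℝ × ℝ × ℝ => parabExt (mollify b h z.1) z.2 := by
  simp_rw [parabExt_mollify hb hh]
  have hc := continuous_mollPhase hh
  refine continuous_of_dominated (bound := fun l => ‖b l‖ * ∫ t, ‖h t‖) (fun z => ?_)
    (fun z => ?_) (hb.norm.mul_const _) ?_
  · exact hb.aestronglyMeasurable.mul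
      (Continuous.comp (g := fun z : (ℝ × ℝ × ℝ) × ℝ => mollPhase h z.1.1 z.1.2 z.2)
        (f := fun l : ℝ => (z, l)) hc (by fun_prop)).aestronglyMeasurable
  · refine Filter.Eventually.of_forall fun l => ?_
    rw [norm_mul]
    gcongr
    exact norm_phaseInt_le _ _ _ _
  · refine Filter.Eventually.of_forall fun l => ?_
    have h1 : Continuous fun z : ℝ × ℝ × ℝ => (z, l) := by fun_prop
    have h2 : Continuous fun z : ℝ × ℝ × ℝ => mollPhase h z.1 z.2 l :=
      Continuous.comp (g := fun z : (ℝ × ℝ × ℝ) × ℝ => mollPhase h z.1.1 z.1.2 z.2)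
        (f := fun z : ℝ × ℝ × ℝ => (z, l)) hc h1
    exact h2.const_mul (b l)

lemma parabExt_mollify_self {b h : ℝ → ℂ} (hb : Integrable b) (hh : Integrable h) (x τ : ℝ) :
    parabExt (mollify b h τ) (x, τ) = (∫ l, b l * unitChar (l * x)) * parabExt h (x, τ) := by
  rw [parabExt_mollify hb hh, ← integral_mul_const]
  refine integral_congr_ae (Filter.Eventually.of_forall fun l => ?_)
  simp only [mollPhase, phaseInt, parabExt]
  rw [mul_assoc (b l), ← integral_const_mul (unitChar (l * x))]
  refine congrArg (b l * ·) (integral_congr_ae (Filter.Eventually.of_forall fun t => ?_))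
  have e : (x + 2 * l * (τ - τ)) * t + τ * t ^ 2 + (l * x + l ^ 2 * (τ - τ)) =
      l * x + (t * x + t ^ 2 * τ) := by ring
  simp only
  rw [e, unitChar_add (l * x)]; ring

/-- If `κ` is a kernel whose transform equals `1` on `[-1, 1]`, then the extension of `h` is
recovered from the extensions of its mollifications. -/
lemma parabExt_reproducing {b h : ℝ → ℂ} (hb : Integrable b) (hh : Integrable h) {κ : ℝ → ℂ}
    (hκ : Integrable κ) (hκ1 : ∀ x, |x| ≤ 1 → ∫ r, κ r * unitChar (r * x) = 1) (M : ℝ)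
    (hM : ∀ t l, h t ≠ 0 → b l ≠ 0 → |(2 * t * l + l ^ 2) * M| ≤ 1) (y : ℝ × ℝ) :
    (∫ l, b l * unitChar (l * y.1)) * parabExt h y =
      ∫ r, κ r * parabExt (mollify b h (y.2 - r * M)) y := by
  have hc := continuous_mollPhase hh
  have hc2 : Continuous fun z : ℝ × ℝ => mollPhase h (y.2 - z.1 * M) y z.2 :=
    hc.comp (f := fun z : ℝ × ℝ => ((y.2 - z.1 * M, y), z.2)) (by fun_prop)
  have hi : Integrable (fun z : ℝ × ℝ => κ z.1 * (b z.2 * mollPhase h (y.2 - z.1 * M) y z.2))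
      (volume.prod volume) := by
    have h1 : Integrable (fun z : ℝ × ℝ => κ z.1 * b z.2) (volume.prod volume) := hκ.mul_prod hb
    refine (h1.norm.mul_const (∫ t, ‖h t‖)).mono' ?_ (Filter.Eventually.of_forall fun z => ?_)
    · refine (h1.aestronglyMeasurable.mul hc2.aestronglyMeasurable).congr
        (Filter.Eventually.of_forall fun z => ?_)
      simp [mul_assoc]
    · rw [← mul_assoc, norm_mul (_ * _)]
      gcongr
      exact norm_phaseInt_le _ _ _ _
  calc (∫ l, b l * unitChar (l * y.1)) * parabExt h y
      = ∫ l, b l * ∫ r, κ r * mollPhase h (y.2 - r * M) y l := by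
        rw [← integral_mul_const]
        refine integral_congr_ae (Filter.Eventually.of_forall fun l => ?_)
        simp only
        by_cases hl : b l = 0
        · simp [hl]
        rw [mul_assoc]
        congr 1
        simp only [mollPhase, phaseInt]
        rw [← integral_mul_integral_unitChar hh hκ (φ := fun t r =>
          (y.1 + 2 * l * (y.2 - (y.2 - r * M))) * t + y.2 * t ^ 2 +
          (l * y.1 + l ^ 2 * (y.2 - (y.2 - r * M)))) (by unfold Function.uncurry; fun_prop)]
        unfold parabExt
        rw [← integral_const_mul]
        refine integral_congr_ae (Filter.Eventually.of_forall fun t => ?_)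
        simp only
        by_cases ht : h t = 0
        · simp [ht]
        have e : ∀ r, κ r * unitChar ((y.1 + 2 * l * (y.2 - (y.2 - r * M))) * t + y.2 * t ^ 2 +
          (l * y.1 + l ^ 2 * (y.2 - (y.2 - r * M)))) =
            (κ r * unitChar (r * ((2 * t * l + l ^ 2) * M))) *
              unitChar (l * y.1 + (t * y.1 + t ^ 2 * y.2)) := by
          intro r
          rw [mul_assoc (κ r), ← unitChar_add]
          congr 2; ring
        simp_rw [e]
        rw [integral_mul_const, hκ1 _ (hM t l ht hl), unitChar_add (l * y.1)]; ring
    _ = ∫ l, ∫ r, κ r * (b l * mollPhase h (y.2 - r * M) y l) := by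
        refine integral_congr_ae (Filter.Eventually.of_forall fun l => ?_)
        simp only
        rw [← integral_const_mul]
        refine integral_congr_ae (Filter.Eventually.of_forall fun r => ?_)
        simp only; ring
    _ = ∫ r, ∫ l, κ r * (b l * mollPhase h (y.2 - r * M) y l) := (integral_integral_swap hi).symm
    _ = _ := by
        refine integral_congr_ae (Filter.Eventually.of_forall fun r => ?_)
        simp only
        rw [parabExt_mollify hb hh, integral_const_mul]

lemma lintegral_comp_mul_left_real {a : ℝ} (ha : 0 < a) {f : ℝ → ℝ≥0∞} (hf : Measurable f) :
    ∫⁻ x, f (a * x) = ENNReal.ofReal a⁻¹ * ∫⁻ x, f x := by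
  have h := Real.map_volume_mul_left ha.ne'
  rw [← lintegral_map (μ := volume) hf (measurable_const_mul a), h, lintegral_smul_measure,
    abs_of_pos (inv_pos.2 ha), smul_eq_mul]

lemma lintegral_comp_div {a : ℝ} (ha : 0 < a) {f : ℝ → ℝ≥0∞} (hf : Measurable f) :
    ∫⁻ x, f (x / a) = ENNReal.ofReal a * ∫⁻ x, f x := by
  have := lintegral_comp_mul_left_real (inv_pos.2 ha) hf
  simpa [inv_mul_eq_div] using this

lemma lintegral_comp_sub_mul {a : ℝ} (ha : 0 < a) (c : ℝ) {f : ℝ → ℝ≥0∞} (hf : Measurable f) :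
    ∫⁻ x, f (c - x * a) = ENNReal.ofReal a⁻¹ * ∫⁻ x, f x := by
  have h := lintegral_comp_mul_left_real ha (f := fun x => f (c - x)) (by fun_prop)
  rw [lintegral_sub_left_eq_self f c] at h
  simpa [mul_comm a] using h

/-- A bump function at scale `1 / M` whose transform is bounded below on `[-M / 2, M / 2]`. -/
lemma exists_mollifier : ∃ C : ℝ≥0, 1 ≤ C ∧ ∀ M : ℝ, 0 < M → ∃ b : ℝ → ℂ, Integrable b ∧
    (∀ l, b l ≠ 0 → |l| < 1 / (6 * M)) ∧
    (∀ x, |x| ≤ M / 2 → 12⁻¹ ≤ ‖∫ l, b l * unitChar (l * x)‖ₑ) ∧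
    ∀ x, ‖∫ l, b l * unitChar (l * x)‖ₑ ≤ C * decay 102 (x / M) := by
  obtain ⟨φ, f, hφf, h0, h1, hf1, hf0⟩ :=
    exists_schwartz_cutoff (a := 1 / 12) (b := 1 / 6) (by norm_num) (by norm_num)
  obtain ⟨ψ, hψ⟩ := exists_schwartz_transform φ
  obtain ⟨C, hC⟩ := schwartz_enorm_le ψ 102
  refine ⟨max 1 C, le_max_left _ _, fun M hM => ⟨fun l => M * φ (M * l), ?_, ?_, ?_, ?_⟩⟩
  · exact (φ.integrable.comp_mul_left' hM.ne').const_mul _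
  · intro l hl
    by_contra h
    apply hl
    simp only
    rw [hφf, hf0]
    · simp
    · rw [abs_mul, abs_of_pos hM]
      rw [not_lt, div_le_iff₀ (by positivity)] at h
      linarith
  all_goals
    have e : ∀ x, ∫ l, (M * φ (M * l)) * unitChar (l * x) = ψ (x / M) := by
      intro x
      rw [hψ]
      have := Measure.integral_comp_mul_left (fun r => φ r * unitChar (r * (x / M))) M
      rw [abs_of_pos (inv_pos.2 hM), Complex.real_smul] at this
      have h2 : ∫ r, φ r * unitChar (r * (x / M)) =
          M * ∫ r, φ (M * r) * unitChar (M * r * (x / M)) := by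
        rw [this, ← mul_assoc, ← Complex.ofReal_mul, mul_inv_cancel₀ hM.ne', Complex.ofReal_one,
          one_mul]
      rw [h2, ← integral_const_mul]
      refine integral_congr_ae (Filter.Eventually.of_forall fun l => ?_)
      have : M * l * (x / M) = l * x := by field_simp
      simp only [this]; ring
  · intro x hx
    rw [e]
    have hz : |x / M| ≤ 1 / 2 := by
      rw [abs_div, abs_of_pos hM, div_le_iff₀ hM]; linarith
    have hfi : Integrable f := by
      have := φ.integrable (μ := volume).re
      refine this.congr (Filter.Eventually.of_forall fun t => ?_)
      simp [hφf]
    have hfm : Measurable f := by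
      have : f = fun t => (φ t).re := by ext t; simp [hφf]
      rw [this]; exact Complex.measurable_re.comp φ.continuous.measurable
    have h2 : ∀ t, f t * (1 / 2) ≤ (φ t * unitChar (t * (x / M))).re := by
      intro t
      by_cases ht : 1 / 6 ≤ |t|
      · simp [hφf, hf0 t ht]
      · rw [hφf, Complex.re_ofReal_mul]
        refine mul_le_mul_of_nonneg_left ?_ (h0 t)
        have : (unitChar (t * (x / M))).re = Real.cos (2 * Real.pi * (t * (x / M))) := by
          unfold unitChar
          rw [show 2 * Real.pi * Complex.I * ((t * (x / M) : ℝ) : ℂ) =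
            ((2 * Real.pi * (t * (x / M)) : ℝ) : ℂ) * Complex.I by push_cast; ring]
          exact Complex.exp_ofReal_mul_I_re _
        rw [this, ← Real.cos_pi_div_three, ← Real.cos_abs (2 * _ * _)]
        apply Real.cos_le_cos_of_nonneg_of_le_pi (abs_nonneg _) (by linarith [Real.pi_pos])
        rw [abs_mul, abs_mul t, abs_of_pos (by positivity)]
        have : |t| * |x / M| ≤ 1 / 6 * (1 / 2) := by
          gcongr; exact (not_le.1 ht).le
        nlinarith [Real.pi_pos]
    have h3 : 1 / 6 ≤ ∫ t, f t := by
      have : ∫ t, (Set.Icc (-(1 / 12) : ℝ) (1 / 12)).indicator (fun _ => (1 : ℝ)) t ≤ ∫ t, f t := by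
        refine integral_mono ((integrable_indicator_iff measurableSet_Icc).2
          (integrableOn_const (by simp))) hfi fun t => ?_
        by_cases ht : t ∈ Set.Icc (-(1 / 12) : ℝ) (1 / 12)
        · simp only [ht, Set.indicator_of_mem]
          rw [hf1 t (abs_le.2 ht)]
        · simp only [ht, not_false_eq_true, Set.indicator_of_notMem]
          exact h0 t
      rw [integral_indicator measurableSet_Icc] at this
      simp at this
      linarith
    have hi := integrable_mul_unitChar (φ.integrable (μ := volume))
      (φ := fun t => t * (x / M)) (by fun_prop)
    have h4 : 1 / 12 ≤ ‖ψ (x / M)‖ := by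
      refine le_trans ?_ (Complex.re_le_norm _)
      rw [hψ]
      have h5 : ∫ t, f t * (1 / 2) ≤ ∫ t, (φ t * unitChar (t * (x / M))).re :=
        integral_mono (hfi.mul_const _) hi.re h2
      rw [integral_mul_const] at h5
      have h6 : ∫ t, (φ t * unitChar (t * (x / M))).re =
          (∫ t, φ t * unitChar (t * (x / M))).re := integral_re hi
      linarith
    rw [← ofReal_norm, show (12 : ℝ≥0∞)⁻¹ = ENNReal.ofReal (1 / 12) by
      rw [one_div, ENNReal.ofReal_inv_of_pos (by norm_num)]; norm_num]
    exact ENNReal.ofReal_le_ofReal h4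
  · intro x
    rw [e]
    refine (hC _).trans ?_
    gcongr
    exact le_max_right _ _

/-- A function supported in the middle parts of the intervals `[k / m, (k + 1) / m]` can be
mollified at scale `1 / m` without mixing the intervals. -/
lemma mem_Ico_of_middle {m t l k : ℝ} (hm : 0 < m) (hl : |l| < 1 / (6 * m))
    (h : (k + 1 / 6) / m ≤ t - l ∧ t - l ≤ (k + 5 / 6) / m) : t ∈ Set.Ico (k / m) ((k + 1) / m) := by
  have h1 := abs_lt.1 hl
  have e : 1 / (6 * m) = (1 / 6) / m := by field_simp
  rw [e] at h1
  obtain ⟨h2, h3⟩ := h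
  rw [add_div] at h2 h3
  rw [Set.mem_Ico, add_div]
  have : 1 / m = 1 / 6 / m + 5 / 6 / m := by field_simp; norm_num
  constructor <;> linarith

lemma decoupling_mollify {p : ℝ} (hp : 0 < p) {m : ℕ} (hm : 0 < m) {D : ℝ} (hD : 0 ≤ D)
    (hDec : DecIneq p m D) {h : ℕ → ℝ → ℂ} (hh : ∀ k, Integrable (h k))
    (hs : ∀ k : ℕ, ∀ t, h k t ≠ 0 → ((k : ℝ) + 1 / 6) / m ≤ t ∧ t ≤ ((k : ℝ) + 5 / 6) / m)
    {b : ℝ → ℂ} (hb : Integrable b) (hbs : ∀ l, b l ≠ 0 → |l| < 1 / (6 * (m : ℝ))) (τ : ℝ)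
    (c : ℝ × ℝ) :
    ∫⁻ y in sqr c ((m : ℝ) ^ 2),
        ‖parabExt (mollify b (fun t => ∑ k ∈ Finset.range m, h k t) τ) y‖ₑ ^ p ≤
      ENNReal.ofReal D ^ p * lpSq p m (fun k => ∫⁻ y, ‖parabExt (mollify b (h k) τ) y‖ₑ ^ p *
        ENNReal.ofReal (wB c ((m : ℝ) ^ 2) y)) := by
  have hm' : (0 : ℝ) < m := by exact_mod_cast hm
  set H := mollify b (fun t => ∑ k ∈ Finset.range m, h k t) τ with hH
  have hsum : Integrable fun t => ∑ k ∈ Finset.range m, h k t :=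
    integrable_finsetSum _ fun k _ => hh k
  have hmem : ∀ k : ℕ, ∀ t l, b l ≠ 0 → h k (t - l) ≠ 0 →
      t ∈ Set.Ico ((k : ℝ) / m) (((k : ℝ) + 1) / m) :=
    fun k t l hl ht => mem_Ico_of_middle hm' (hbs l hl) (hs k _ ht)
  have hpiece : ∀ k < m, (Set.Ico ((k : ℝ) / m) (((k : ℝ) + 1) / m)).indicator H =
      mollify b (h k) τ := by
    intro k hk
    ext t
    by_cases ht : t ∈ Set.Ico ((k : ℝ) / m) (((k : ℝ) + 1) / m)
    · rw [Set.indicator_of_mem ht, hH]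
      refine mollify_congr fun l hl => ?_
      refine Finset.sum_eq_single k (fun j _ hjk => ?_) (fun h => absurd (Finset.mem_range.2 hk) h)
      by_contra hj
      have h1 := hmem j t l hl hj
      rw [Set.mem_Ico, div_le_iff₀ hm', lt_div_iff₀ hm'] at ht h1
      apply hjk
      have a1 : (j : ℝ) < k + 1 := by linarith
      have a2 : (k : ℝ) < j + 1 := by linarith
      have b1 : j < k + 1 := by exact_mod_cast a1
      have b2 : k < j + 1 := by exact_mod_cast a2
      omega
    · rw [Set.indicator_of_notMem ht, ← mollify_zero b τ t]
      refine mollify_congr fun l hl => ?_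
      by_contra hj
      exact ht (hmem k t l hl (Ne.symm hj))
  have hfull : (Set.Ico 0 1).indicator H = H := by
    refine Set.indicator_eq_self.2 fun t ht => ?_
    by_contra hn
    apply ht
    rw [hH, ← mollify_zero b τ t]
    refine mollify_congr fun l hl => Finset.sum_eq_zero fun k hk => ?_
    by_contra hj
    apply hn
    obtain ⟨h1, h2⟩ := hmem k t l hl hj
    refine ⟨le_trans (by positivity) h1, h2.trans_le ?_⟩
    rw [div_le_one hm']
    exact_mod_cast Finset.mem_range.1 hk
  have key := (decIneq_iff hp hm hD).1 hDec H (integrable_mollify hb hsum τ).integrableOn c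
  rw [hfull] at key
  refine key.trans ?_
  gcongr
  exact lpSq_mono hp fun k hk => by rw [hpiece k hk]

lemma ofReal_wB_le (c : ℝ × ℝ) {R : ℝ} (hR : 0 < R) (y : ℝ × ℝ) :
    ENNReal.ofReal (wB c R y) ≤ decay 100 ((y.2 - c.2) / R) := by
  rw [wB_eq]
  unfold decay
  gcongr
  rw [abs_div, abs_of_pos hR]
  gcongr
  exact Real.abs_le_sqrt (by nlinarith [sq_nonneg (y.1 - c.1)])

lemma growth_two_mul_le (N : ℕ) (x : ℝ) : growth N (2 * x) ≤ 2 ^ N * growth N x := by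
  unfold growth
  rw [show (2 : ℝ≥0∞) ^ N = ENNReal.ofReal (2 ^ N) by
    rw [ENNReal.ofReal_pow (by norm_num)]; norm_num, ← ENNReal.ofReal_mul (by positivity), ← mul_pow]
  gcongr
  rw [abs_mul, abs_two]; linarith

lemma growth_neg (N : ℕ) (x : ℝ) : growth N (-x) = growth N x := by simp [growth]

lemma growth_one_pow (N : ℕ) (x : ℝ) : growth 1 x ^ N = growth N x := by
  unfold growth
  rw [← ENNReal.ofReal_pow (by positivity), pow_one]

lemma decay_le_one (N : ℕ) (x : ℝ) : decay N x ≤ 1 := by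
  unfold decay
  rw [ENNReal.ofReal_le_one]
  exact inv_le_one_of_one_le₀ (one_le_pow₀ (by linarith [abs_nonneg x]))

lemma decay_sub_le (N : ℕ) {x : ℝ} (hx : |x| ≤ 1) (y : ℝ) :
    decay N (x - y) ≤ 2 ^ N * decay N y := by
  unfold decay
  rw [show (2 : ℝ≥0∞) ^ N = ENNReal.ofReal (2 ^ N) by
    rw [ENNReal.ofReal_pow (by norm_num)]; norm_num, ← ENNReal.ofReal_mul (by positivity)]
  gcongr
  rw [← div_eq_mul_inv, inv_eq_one_div, div_le_div_iff₀ (by positivity) (by positivity), ← mul_pow,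
    one_mul]
  gcongr
  have := abs_sub_abs_le_abs_sub y x
  rw [abs_sub_comm y x] at this
  linarith [abs_nonneg (x - y)]

lemma rpow_le_pow_six {c : ℝ≥0∞} (hc : 1 ≤ c) {p : ℝ} (hp : p ≤ 6) : c ^ p ≤ c ^ 6 := by
  rw [show c ^ 6 = c ^ (6 : ℝ) by rw [← ENNReal.rpow_natCast]; norm_num]
  exact ENNReal.rpow_le_rpow_of_exponent_le hc hp

lemma rpow_le_self {c : ℝ≥0∞} (hc : c ≤ 1) {p : ℝ} (hp : 1 ≤ p) : c ^ p ≤ c := by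
  simpa using ENNReal.rpow_le_rpow_of_exponent_ge hc hp

lemma exists_lintegral_mollify_piece_le (C₀ : ℝ≥0) (hC₀ : 1 ≤ C₀) :
    ∃ C : ℝ≥0, ∀ p : ℝ, 4 < p → p < 6 → ∀ m : ℕ, 0 < m → ∀ k : ℕ, ∀ h : ℝ → ℂ, Integrable h →
    (∀ t, h t ≠ 0 → ((k : ℝ) + 1 / 6) / m ≤ t ∧ t ≤ ((k : ℝ) + 5 / 6) / m) →
    ∀ b : ℝ → ℂ, Integrable b → (∀ l, b l ≠ 0 → |l| < 1 / (6 * (m : ℝ))) →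
    (∀ x, ‖∫ l, b l * unitChar (l * x)‖ₑ ≤ C₀ * decay 102 (x / (m : ℝ) ^ 2)) → ∀ τ : ℝ,
    ∫⁻ y, ‖parabExt (mollify b h τ) y‖ₑ ^ p * ENNReal.ofReal (wB 0 ((m : ℝ) ^ 2) y) ≤
      C * ENNReal.ofReal ((m : ℝ) ^ 2) * growth 6 (τ / (m : ℝ) ^ 2) *
        ∫⁻ x, decay 102 (x / (m : ℝ) ^ 2) * ‖parabExt h (x, τ)‖ₑ ^ p := by
  obtain ⟨C₁, hC₁, hev⟩ := exists_lintegral_parabExt_evolve_le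
  have hfin := (lintegral_decay_lt_top (N := 94) (by norm_num)).ne
  refine ⟨C₁ ^ 6 * 2 ^ 6 * (∫⁻ x, decay 94 x).toNNReal * C₀ ^ 6,
    fun p hp4 hp6 m hm k h hh hs b hb hbs hψ τ => ?_⟩
  have hm' : (0 : ℝ) < m := by exact_mod_cast hm
  set M : ℝ := (m : ℝ) ^ 2 with hM
  have hM0 : 0 < M := by positivity
  set H := mollify b h τ with hH
  have hHi : Integrable H := integrable_mollify hb hh τ
  have hsupp : ∀ t, H t ≠ 0 → |(m : ℝ) * t + -k| ≤ 1 := by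
    intro t ht
    have : t ∈ Set.Ico ((k : ℝ) / m) (((k : ℝ) + 1) / m) := by
      by_contra hn
      apply ht
      rw [hH, ← mollify_zero b τ t]
      refine mollify_congr fun l hl => ?_
      by_contra hj
      exact hn (mem_Ico_of_middle hm' (hbs l hl) (hs _ hj))
    rw [Set.mem_Ico, div_le_iff₀ hm', lt_div_iff₀ hm'] at this
    rw [abs_le]; constructor <;> linarith
  have hFm := measurable_enorm_parabExt hHi
  have hline : ∫⁻ x, ‖parabExt H (x, τ)‖ₑ ^ p ≤
      C₀ ^ 6 * ∫⁻ x, decay 102 (x / M) * ‖parabExt h (x, τ)‖ₑ ^ p := by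
    have hmm : Measurable fun x => decay 102 (x / M) * ‖parabExt h (x, τ)‖ₑ ^ p :=
      ((measurable_decay 102).comp (by fun_prop)).mul
        (((measurable_enorm_parabExt hh).comp (by fun_prop)).pow_const p)
    rw [← lintegral_const_mul _ hmm]
    refine lintegral_mono fun x => ?_
    rw [hH, parabExt_mollify_self hb hh, enorm_mul, ENNReal.mul_rpow_of_nonneg _ _ (by linarith),
      ← mul_assoc]
    gcongr
    calc _ ≤ (C₀ * decay 102 (x / M)) ^ p := by
          gcongr
          exact hψ x
      _ = C₀ ^ p * decay 102 (x / M) ^ p := ENNReal.mul_rpow_of_nonneg _ _ (by linarith)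
      _ ≤ _ := by
          gcongr
          · exact rpow_le_pow_six (by exact_mod_cast hC₀) hp6.le
          · exact rpow_le_self (decay_le_one _ _) (by linarith)
  have hgrow : ∀ s, (C₁ * growth 1 (2 * ((s - τ) / M))) ^ p ≤
      C₁ ^ 6 * 2 ^ 6 * growth 6 (τ / M) * growth 6 (s / M) := by
    intro s
    have h1 : (1 : ℝ≥0∞) ≤ C₁ := by exact_mod_cast hC₁
    refine (rpow_le_pow_six (one_le_mul h1 (one_le_growth _ _)) hp6.le).trans ?_
    rw [mul_pow, growth_one_pow]
    calc _ ≤ C₁ ^ 6 * (2 ^ 6 * (growth 6 (s / M) * growth 6 (-(τ / M)))) := by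
          gcongr
          refine (growth_two_mul_le _ _).trans ?_
          gcongr
          rw [sub_div, sub_eq_add_neg]
          exact growth_add_le _ _ _
      _ = _ := by rw [growth_neg]; ring
  calc ∫⁻ y, ‖parabExt H y‖ₑ ^ p * ENNReal.ofReal (wB 0 M y)
      ≤ ∫⁻ y : ℝ × ℝ, ‖parabExt H y‖ₑ ^ p * decay 100 (y.2 / M) := by
        refine lintegral_mono fun y => ?_
        gcongr
        simpa using ofReal_wB_le 0 hM0 y
    _ = ∫⁻ s, ∫⁻ x, ‖parabExt H (x, s)‖ₑ ^ p * decay 100 (s / M) := by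
        rw [Measure.volume_eq_prod, lintegral_prod_symm]
        exact ((hFm.pow_const p).mul ((measurable_decay 100).comp (by fun_prop))).aemeasurable
    _ ≤ ∫⁻ s, (C₁ ^ 6 * 2 ^ 6 * growth 6 (τ / M) * ∫⁻ x, ‖parabExt H (x, τ)‖ₑ ^ p) *
          decay 94 (s / M) := by
        refine lintegral_mono fun s => ?_
        have hm1 : Measurable fun x => ‖parabExt H (x, s)‖ₑ ^ p :=
          (hFm.comp (by fun_prop : Measurable fun x : ℝ => (x, s))).pow_const p
        rw [lintegral_mul_const _ hm1]
        calc _ ≤ (C₁ ^ 6 * 2 ^ 6 * growth 6 (τ / M) * growth 6 (s / M) *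
                ∫⁻ x, ‖parabExt H (x, τ)‖ₑ ^ p) * decay 100 (s / M) := by
              gcongr
              refine (hev p (by linarith) m (-k) hm' H hHi hsupp s τ).trans ?_
              gcongr
              exact hgrow s
          _ = (C₁ ^ 6 * 2 ^ 6 * growth 6 (τ / M) * ∫⁻ x, ‖parabExt H (x, τ)‖ₑ ^ p) *
                ((growth 6 (s / M) * decay 6 (s / M)) * decay 94 (s / M)) := by
              rw [show (100 : ℕ) = 6 + 94 from rfl, decay_add]; ring
          _ = _ := by rw [growth_mul_decay, one_mul]
    _ = (C₁ ^ 6 * 2 ^ 6 * growth 6 (τ / M) * ∫⁻ x, ‖parabExt H (x, τ)‖ₑ ^ p) *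
          (ENNReal.ofReal M * ∫⁻ x, decay 94 x) := by
        rw [lintegral_const_mul _ (by fun_prop), lintegral_comp_div hM0 (by fun_prop)]
    _ ≤ (C₁ ^ 6 * 2 ^ 6 * growth 6 (τ / M) *
          (C₀ ^ 6 * ∫⁻ x, decay 102 (x / M) * ‖parabExt h (x, τ)‖ₑ ^ p)) *
          (ENNReal.ofReal M * ∫⁻ x, decay 94 x) := by gcongr
    _ = _ := by
        push_cast
        rw [ENNReal.coe_toNNReal hfin]
        ring

lemma exists_lintegral_sqr_reproducing_le :
    ∃ C : ℝ≥0, ∀ p : ℝ, 4 < p → p < 6 → ∀ M : ℝ, 0 < M → ∀ h : ℝ → ℂ, Integrable h →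
    ∀ b : ℝ → ℂ, Integrable b → (∀ t l, h t ≠ 0 → b l ≠ 0 → |(2 * t * l + l ^ 2) * M| ≤ 1) →
    (∀ x, |x| ≤ M / 2 → 12⁻¹ ≤ ‖∫ l, b l * unitChar (l * x)‖ₑ) →
    ∫⁻ y in sqr 0 M, ‖parabExt h y‖ₑ ^ p ≤ C * ENNReal.ofReal M⁻¹ *
      ∫⁻ τ, decay 106 (τ / M) * ∫⁻ y in sqr 0 M, ‖parabExt (mollify b h τ) y‖ₑ ^ p := by
  obtain ⟨φ, f, hφf, -, -, hf1, -⟩ := exists_schwartz_cutoff (a := 1) (b := 2) one_pos (by norm_num)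
  obtain ⟨κ, hκ⟩ := exists_schwartz_kernel φ
  have hκ1 : ∀ x, |x| ≤ 1 → ∫ r, κ r * unitChar (r * x) = 1 := by
    intro x hx
    rw [← hκ, hφf, hf1 x hx, Complex.ofReal_one]
  obtain ⟨C₂, hC₂⟩ := schwartz_enorm_le κ 106
  set K : ℝ≥0∞ := ∫⁻ r, ‖κ r‖ₑ with hK
  have hKfin : K < ⊤ := κ.integrable.2
  refine ⟨12 ^ 6 * (max 1 K.toNNReal) ^ 6 * (C₂ * 2 ^ 106), ?_⟩
  intro p hp4 hp6 M hM h hh b hb hsupp hψ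
  have hp0 : 0 ≤ p := by linarith
  have hGc := continuous_parabExt_mollify hb hh
  obtain ⟨G, hG⟩ : ∃ G : ℝ × ℝ × ℝ → ℝ≥0∞, ∀ τ y, G (τ, y) = ‖parabExt (mollify b h τ) y‖ₑ ^ p :=
    ⟨fun z => ‖parabExt (mollify b h z.1) z.2‖ₑ ^ p, fun _ _ => rfl⟩
  have hGm : Measurable G := by
    have : G = fun z => ‖parabExt (mollify b h z.1) z.2‖ₑ ^ p := by
      ext ⟨τ, y⟩; exact hG τ y
    rw [this]
    exact hGc.measurable.enorm.pow_const p
  obtain ⟨a, ha⟩ : ∃ a : ℝ → ℝ≥0∞, ∀ r, a r = ‖κ r‖ₑ := ⟨_, fun _ => rfl⟩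
  have ham : Measurable a := by
    rw [show a = fun r => ‖κ r‖ₑ from funext ha]; exact κ.continuous.measurable.enorm
  have hpt : ∀ y ∈ sqr 0 M, ‖parabExt h y‖ₑ ^ p ≤
      12 ^ 6 * (max 1 K) ^ 6 * ∫⁻ r, a r * G (y.2 - r * M, y) := by
    intro y hy
    have hy1 : |y.1| ≤ M / 2 := by
      rw [abs_le]
      have := hy.1
      simpa [neg_div] using this
    have h1 := parabExt_reproducing hb hh κ.integrable hκ1 M hsupp y
    have h2 : 12⁻¹ * ‖parabExt h y‖ₑ ≤
        ∫⁻ r, a r * ‖parabExt (mollify b h (y.2 - r * M)) y‖ₑ := by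
      calc _ ≤ ‖(∫ l, b l * unitChar (l * y.1)) * parabExt h y‖ₑ := by
            rw [enorm_mul]; gcongr; exact hψ _ hy1
        _ ≤ _ := by
            rw [h1]
            refine (enorm_integral_le_lintegral_enorm _).trans (le_of_eq ?_)
            simp_rw [enorm_mul, ha]
    have h3 : ‖parabExt h y‖ₑ ≤ 12 * ∫⁻ r, a r * ‖parabExt (mollify b h (y.2 - r * M)) y‖ₑ := by
      calc ‖parabExt h y‖ₑ = 12 * (12⁻¹ * ‖parabExt h y‖ₑ) := by
            rw [← mul_assoc, ENNReal.mul_inv_cancel (by norm_num) (by norm_num), one_mul]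
        _ ≤ _ := by gcongr
    have hm1 : Measurable fun r => ‖parabExt (mollify b h (y.2 - r * M)) y‖ₑ := by
      have h5 : Continuous fun r : ℝ => parabExt (mollify b h (y.2 - r * M)) y :=
        Continuous.comp (g := fun z : ℝ × ℝ × ℝ => parabExt (mollify b h z.1) z.2)
          (f := fun r : ℝ => (y.2 - r * M, y)) hGc (by fun_prop)
      exact h5.measurable.enorm
    calc _ ≤ (12 * ∫⁻ r, a r * ‖parabExt (mollify b h (y.2 - r * M)) y‖ₑ) ^ p := by gcongr
      _ = 12 ^ p * (∫⁻ r, a r * ‖parabExt (mollify b h (y.2 - r * M)) y‖ₑ) ^ p :=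
          ENNReal.mul_rpow_of_nonneg _ _ hp0
      _ ≤ 12 ^ 6 * ((max 1 K) ^ 6 *
            ∫⁻ r, a r * ‖parabExt (mollify b h (y.2 - r * M)) y‖ₑ ^ p) := by
          gcongr
          · exact rpow_le_pow_six (by norm_num) hp6.le
          · refine (lintegral_mul_rpow_le (by linarith) ham hm1).trans ?_
            gcongr
            simp_rw [ha]
            rw [← hK]
            calc K ^ (p - 1) ≤ (max 1 K) ^ (p - 1) :=
                  ENNReal.rpow_le_rpow (le_max_right _ _) (by linarith)
              _ ≤ _ := rpow_le_pow_six (le_max_left _ _) (by linarith)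
      _ = _ := by simp_rw [hG]; ring
  calc ∫⁻ y in sqr 0 M, ‖parabExt h y‖ₑ ^ p
      ≤ ∫⁻ y in sqr 0 M, 12 ^ 6 * (max 1 K) ^ 6 * ∫⁻ r, a r * G (y.2 - r * M, y) :=
        setLIntegral_mono' (measurableSet_sqr 0 M) hpt
    _ ≤ ∫⁻ y in sqr 0 M, 12 ^ 6 * (max 1 K) ^ 6 * (ENNReal.ofReal M⁻¹ *
          ∫⁻ τ, (C₂ * 2 ^ 106) * (decay 106 (τ / M) * G (τ, y))) := by
        refine setLIntegral_mono' (measurableSet_sqr 0 M) fun y hy => ?_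
        gcongr
        have e := lintegral_comp_sub_mul hM y.2 (f := fun τ => a ((y.2 - τ) / M) * G (τ, y))
          (by fun_prop)
        simp only [sub_sub_cancel, mul_div_cancel_right₀ _ hM.ne'] at e
        rw [e]
        refine mul_le_mul_right (lintegral_mono fun τ => ?_) _
        rw [← mul_assoc (_ * _)]
        refine mul_le_mul_left ?_ _
        rw [ha, mul_assoc]
        refine (hC₂ _).trans ?_
        refine mul_le_mul_right ?_ _
        rw [sub_div]
        refine decay_sub_le _ ?_ _
        have hy2 : |y.2| ≤ M / 2 := by
          rw [abs_le]
          have := hy.2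
          simpa [neg_div] using this
        rw [abs_div, abs_of_pos hM, div_le_one hM]
        linarith
    _ = 12 ^ 6 * (max 1 K) ^ 6 * (C₂ * 2 ^ 106) * ENNReal.ofReal M⁻¹ *
          ∫⁻ y in sqr 0 M, ∫⁻ τ, decay 106 (τ / M) * G (τ, y) := by
        rw [← lintegral_const_mul _ (by fun_prop)]
        refine lintegral_congr fun y => ?_
        rw [lintegral_const_mul _ (by fun_prop)]
        ring
    _ = 12 ^ 6 * (max 1 K) ^ 6 * (C₂ * 2 ^ 106) * ENNReal.ofReal M⁻¹ *
          ∫⁻ τ, decay 106 (τ / M) * ∫⁻ y in sqr 0 M, G (τ, y) := by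
        rw [lintegral_lintegral_swap (by fun_prop)]
        congr 2
        ext τ
        rw [lintegral_const_mul _ (by fun_prop)]
    _ = _ := by
        simp_rw [hG]
        push_cast
        rw [ENNReal.coe_toNNReal hKfin.ne]

lemma exists_local_decoupling_zero :
    ∃ C : ℝ≥0, ∀ p : ℝ, 4 < p → p < 6 → ∀ m : ℕ, 0 < m → ∀ D : ℝ, 0 ≤ D → DecIneq p m D →
    ∀ h : ℕ → ℝ → ℂ, (∀ k, Integrable (h k)) →
    (∀ k : ℕ, ∀ t, h k t ≠ 0 → ((k : ℝ) + 1 / 6) / m ≤ t ∧ t ≤ ((k : ℝ) + 5 / 6) / m) →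
    ∫⁻ y in sqr 0 ((m : ℝ) ^ 2), ‖parabExt (fun t => ∑ k ∈ Finset.range m, h k t) y‖ₑ ^ p ≤
      C * ENNReal.ofReal D ^ p * ∫⁻ τ, decay 100 (τ / (m : ℝ) ^ 2) *
        lpSq p m (fun k => ∫⁻ x, decay 102 (x / (m : ℝ) ^ 2) * ‖parabExt (h k) (x, τ)‖ₑ ^ p) := by
  obtain ⟨C₀, hC₀, hmol⟩ := exists_mollifier
  obtain ⟨C₂, hpiece⟩ := exists_lintegral_mollify_piece_le C₀ hC₀
  obtain ⟨C₃, hrep⟩ := exists_lintegral_sqr_reproducing_le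
  refine ⟨C₃ * C₂, fun p hp4 hp6 m hm D hD hDec h hh hs => ?_⟩
  have hp0 : 0 < p := by linarith
  have hm' : (1 : ℝ) ≤ m := by exact_mod_cast hm
  set M : ℝ := (m : ℝ) ^ 2 with hM
  have hmM : (m : ℝ) ≤ M := by nlinarith
  have hM0 : 0 < M := by positivity
  obtain ⟨b, hb, hbs, hlow, hup⟩ := hmol M hM0
  have hbs' : ∀ l, b l ≠ 0 → |l| < 1 / (6 * (m : ℝ)) := fun l hl =>
    (hbs l hl).trans_le (by gcongr)
  set g : ℝ → ℂ := fun t => ∑ k ∈ Finset.range m, h k t with hg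
  have hgi : Integrable g := integrable_finsetSum _ fun k _ => hh k
  have hsupp : ∀ t l, g t ≠ 0 → b l ≠ 0 → |(2 * t * l + l ^ 2) * M| ≤ 1 := by
    intro t l ht hl
    obtain ⟨k, hk, hkt⟩ := Finset.exists_ne_zero_of_sum_ne_zero ht
    obtain ⟨h1, h2⟩ := hs k t hkt
    have hk' : (k : ℝ) + 1 ≤ m := by exact_mod_cast Finset.mem_range.1 hk
    have ht0 : 0 ≤ t := le_trans (by positivity) h1
    have ht1 : t ≤ 1 := h2.trans (by rw [div_le_one (by linarith)]; linarith)
    have h3 := (hbs l hl).le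
    rw [le_div_iff₀ (by positivity)] at h3
    have h4 : |l| * M ≤ 1 / 6 := by linarith
    have h5 : |l| ≤ 1 / 6 := by nlinarith [abs_nonneg l]
    have e : (2 * t * l + l ^ 2) * M = (2 * t + l) * (l * M) := by ring
    rw [e, abs_mul, abs_mul l, abs_of_pos hM0]
    have h6 : |2 * t + l| ≤ 3 := by
      have := abs_le.1 h5
      rw [abs_le]; constructor <;> linarith
    calc _ ≤ 3 * (1 / 6 : ℝ) := by gcongr
      _ ≤ 1 := by norm_num
  obtain ⟨A, hA⟩ : ∃ A : ℝ → ℕ → ℝ≥0∞, ∀ τ k, A τ k =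
    ∫⁻ x, decay 102 (x / M) * ‖parabExt (h k) (x, τ)‖ₑ ^ p := ⟨_, fun _ _ => rfl⟩
  have hstep : ∀ τ, ∫⁻ y in sqr 0 M, ‖parabExt (mollify b g τ) y‖ₑ ^ p ≤
      ENNReal.ofReal D ^ p * ((C₂ * ENNReal.ofReal M * growth 6 (τ / M)) * lpSq p m (A τ)) := by
    intro τ
    refine (decoupling_mollify hp0 hm hD hDec hh hs hb hbs' τ 0).trans ?_
    rw [← lpSq_const_mul hp0 m (C₂ * ENNReal.ofReal M * growth 6 (τ / M))]
    refine mul_le_mul_right (lpSq_mono hp0 fun k hk => ?_) _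
    rw [hA]
    exact hpiece p hp4 hp6 m hm k (h k) (hh k) (hs k) b hb hbs' hup τ
  calc ∫⁻ y in sqr 0 M, ‖parabExt g y‖ₑ ^ p
      ≤ C₃ * ENNReal.ofReal M⁻¹ *
        ∫⁻ τ, decay 106 (τ / M) * ∫⁻ y in sqr 0 M, ‖parabExt (mollify b g τ) y‖ₑ ^ p :=
        hrep p hp4 hp6 M hM0 g hgi b hb hsupp hlow
    _ ≤ C₃ * ENNReal.ofReal M⁻¹ * ∫⁻ τ, (ENNReal.ofReal D ^ p * (C₂ * ENNReal.ofReal M)) *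
          (decay 100 (τ / M) * lpSq p m (A τ)) := by
        refine mul_le_mul_right (lintegral_mono fun τ => ?_) _
        refine (mul_le_mul_right (hstep τ) _).trans (le_of_eq ?_)
        rw [show (106 : ℕ) = 6 + 100 from rfl, decay_add]
        calc _ = ENNReal.ofReal D ^ p * (C₂ * ENNReal.ofReal M) *
              (decay 100 (τ / M) * lpSq p m (A τ)) * (growth 6 (τ / M) * decay 6 (τ / M)) := by ring
          _ = _ := by rw [growth_mul_decay, mul_one]
    _ = C₃ * C₂ * ENNReal.ofReal D ^ p * (ENNReal.ofReal M⁻¹ * ENNReal.ofReal M) *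
          ∫⁻ τ, decay 100 (τ / M) * lpSq p m (A τ) := by
        rw [lintegral_const_mul']
        · ring
        · exact ENNReal.mul_ne_top (ENNReal.rpow_ne_top_of_nonneg hp0.le ENNReal.ofReal_ne_top)
            (ENNReal.mul_ne_top ENNReal.coe_ne_top ENNReal.ofReal_ne_top)
    _ = _ := by
        rw [← ENNReal.ofReal_mul (by positivity), inv_mul_cancel₀ hM0.ne', ENNReal.ofReal_one,
          mul_one, ENNReal.coe_mul]
        simp_rw [← hA]

/-- Local decoupling with weights adapted to horizontal lines. -/
lemma exists_local_decoupling :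
    ∃ C : ℝ≥0, ∀ p : ℝ, 4 < p → p < 6 → ∀ m : ℕ, 0 < m → ∀ D : ℝ, 0 ≤ D → DecIneq p m D →
    ∀ h : ℕ → ℝ → ℂ, (∀ k, Integrable (h k)) →
    (∀ k : ℕ, ∀ t, h k t ≠ 0 → ((k : ℝ) + 1 / 6) / m ≤ t ∧ t ≤ ((k : ℝ) + 5 / 6) / m) →
    ∀ c : ℝ × ℝ, ∫⁻ y in sqr 0 ((m : ℝ) ^ 2),
        ‖parabExt (fun t => ∑ k ∈ Finset.range m, h k t) (c + y)‖ₑ ^ p ≤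
      C * ENNReal.ofReal D ^ p * ∫⁻ τ, decay 100 (τ / (m : ℝ) ^ 2) *
        lpSq p m (fun k => ∫⁻ x, decay 102 (x / (m : ℝ) ^ 2) *
          ‖parabExt (h k) (c + (x, τ))‖ₑ ^ p) := by
  obtain ⟨C, hC⟩ := exists_local_decoupling_zero
  refine ⟨C, fun p hp4 hp6 m hm D hD hDec h hh hs c => ?_⟩
  have := hC p hp4 hp6 m hm D hD hDec (fun k t => h k t * unitChar (t * c.1 + t ^ 2 * c.2))
    (fun k => integrable_mul_unitChar (hh k) (by fun_prop))
    (fun k t ht => hs k t (left_ne_zero_of_mul ht))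
  simpa only [← Finset.sum_mul, parabExt_modulate] using this

/-- The linear map of the plane dual to the parabolic change of variables `t ↦ u + σ t`. -/
def parabMap (u σ : ℝ) (x : ℝ × ℝ) : ℝ × ℝ := (σ * (x.1 + 2 * u * x.2), σ ^ 2 * x.2)

@[fun_prop]
lemma measurable_parabMap (u σ : ℝ) : Measurable (parabMap u σ) := by
  unfold parabMap
  fun_prop

lemma lintegral_comp_parabMap {u σ : ℝ} (hσ : 0 < σ) {f : ℝ × ℝ → ℝ≥0∞} (hf : Measurable f) :
    ∫⁻ x, f (parabMap u σ x) = ENNReal.ofReal (σ ^ 3)⁻¹ * ∫⁻ y, f y := by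
  rw [Measure.volume_eq_prod, lintegral_prod_symm _ (by fun_prop),
    lintegral_prod_symm _ (by fun_prop)]
  have hin : ∀ s, ∫⁻ x, f (parabMap u σ (x, s)) =
      ENNReal.ofReal σ⁻¹ * ∫⁻ x, f (x, σ ^ 2 * s) := by
    intro s
    rw [← lintegral_comp_mul_left_real hσ (f := fun x => f (x, σ ^ 2 * s)) (by fun_prop)]
    exact lintegral_add_right_eq_self (fun x => f (σ * x, σ ^ 2 * s)) (2 * u * s)
  simp_rw [hin]
  rw [lintegral_const_mul' _ _ ENNReal.ofReal_ne_top,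
    lintegral_comp_mul_left_real (by positivity) (f := fun s => ∫⁻ x, f (x, s))
      (Measurable.lintegral_prod_left (by fun_prop)),
    ← mul_assoc, ← ENNReal.ofReal_mul (by positivity)]
  congr 2
  rw [← mul_inv]
  ring_nf

lemma enorm_parabExt_rescale {u σ : ℝ} (hσ : 0 < σ) (G : ℝ → ℂ) (x : ℝ × ℝ) :
    ‖parabExt G x‖ₑ = ‖parabExt (fun t => σ * G (u + σ * t)) (parabMap u σ x)‖ₑ := by
  have h : parabExt G x = unitChar (u * x.1 + u ^ 2 * x.2) *
      parabExt (fun t => σ * G (u + σ * t)) (parabMap u σ x) := by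
    set F : ℝ → ℂ := fun t => G t * unitChar (t * x.1 + t ^ 2 * x.2) with hF
    have h1 : ∫ t, F t = (σ : ℂ) * ∫ t, F (u + σ * t) := by
      rw [Measure.integral_comp_mul_left (fun t => F (u + t)), integral_add_left_eq_self,
        abs_of_pos (by positivity), Complex.real_smul, ← mul_assoc, ← Complex.ofReal_mul,
        mul_inv_cancel₀ hσ.ne', Complex.ofReal_one, one_mul]
    unfold parabExt
    rw [show (∫ t, G t * unitChar (t * x.1 + t ^ 2 * x.2)) = ∫ t, F t from rfl, h1,
      ← integral_const_mul, ← integral_const_mul]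
    congr 1 with t
    simp only [hF]
    rw [show (u + σ * t) * x.1 + (u + σ * t) ^ 2 * x.2 = (u * x.1 + u ^ 2 * x.2) +
      (t * (parabMap u σ x).1 + t ^ 2 * (parabMap u σ x).2) by unfold parabMap; ring,
      unitChar_add]
    ring
  rw [h, enorm_mul, enorm_unitChar, one_mul]

lemma decay_le_of_le {N : ℕ} {K v w : ℝ} (hK : 0 ≤ K) (h : 1 + |w| ≤ K * (1 + |v|)) :
    decay N v ≤ ENNReal.ofReal (K ^ N) * decay N w := by
  unfold decay
  rw [← ENNReal.ofReal_mul (by positivity)]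
  refine ENNReal.ofReal_le_ofReal ?_
  rw [← div_eq_mul_inv, le_div_iff₀ (by positivity), inv_mul_le_iff₀ (by positivity), mul_comm,
    ← mul_pow]
  gcongr

lemma exists_lintegral_decay_average_le : ∃ C : ℝ≥0, ∀ M σ : ℝ, 0 < M → 0 < σ → σ ≤ 1 → ∀ x : ℝ,
    ENNReal.ofReal M⁻¹ * ∫⁻ α in Set.Icc (-(3 * M / σ)) (3 * M / σ), decay 102 ((x - α) / M) ≤
      C * decay 100 (σ * x / M) := by
  refine ⟨(4 ^ 100 : ℝ≥0) * (∫⁻ x, decay 2 x).toNNReal, fun M σ hM hσ hσ1 x => ?_⟩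
  have h1 : ∀ α ∈ Set.Icc (-(3 * M / σ)) (3 * M / σ), decay 102 ((x - α) / M) ≤
      (ENNReal.ofReal (4 ^ 100) * decay 100 (σ * x / M)) * decay 2 ((x - α) / M) := by
    intro α hα
    rw [show (102 : ℕ) = 100 + 2 from rfl, decay_add]
    refine mul_le_mul_left (decay_le_of_le (by norm_num) ?_) _
    have h2 : |σ * α / M| ≤ 3 := by
      have h3 := abs_le.2 hα
      rw [le_div_iff₀ hσ] at h3
      rw [abs_div, abs_mul, abs_of_pos hσ, abs_of_pos hM, div_le_iff₀ hM]
      linarith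
    have h4 : |σ * ((x - α) / M)| ≤ |(x - α) / M| := by
      rw [abs_mul, abs_of_pos hσ]
      exact mul_le_of_le_one_left (abs_nonneg _) hσ1
    have h5 : |σ * x / M| ≤ |σ * ((x - α) / M)| + |σ * α / M| := by
      rw [show σ * x / M = σ * ((x - α) / M) + σ * α / M by ring]
      exact abs_add_le _ _
    linarith [abs_nonneg ((x - α) / M)]
  calc _ ≤ ENNReal.ofReal M⁻¹ * ∫⁻ α,
        (ENNReal.ofReal (4 ^ 100) * decay 100 (σ * x / M)) * decay 2 ((x - α) / M) := by
        refine mul_le_mul_right ?_ _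
        exact (setLIntegral_mono' measurableSet_Icc h1).trans (setLIntegral_le_lintegral _ _)
    _ = ENNReal.ofReal M⁻¹ * ((ENNReal.ofReal (4 ^ 100) * decay 100 (σ * x / M)) *
          (ENNReal.ofReal M * ∫⁻ x, decay 2 x)) := by
        rw [lintegral_const_mul _ (by fun_prop)]
        congr 2
        have := lintegral_comp_sub_mul (inv_pos.2 hM) (x / M) (measurable_decay 2)
        rw [inv_inv] at this
        rw [← this]
        congr 1 with α
        congr 1
        field_simp
    _ = (ENNReal.ofReal M⁻¹ * ENNReal.ofReal M) * (ENNReal.ofReal (4 ^ 100) *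
          (∫⁻ x, decay 2 x) * decay 100 (σ * x / M)) := by ring
    _ = _ := by
        rw [← ENNReal.ofReal_mul (by positivity), inv_mul_cancel₀ hM.ne', ENNReal.ofReal_one,
          one_mul, ENNReal.coe_mul, ENNReal.coe_toNNReal (lintegral_decay_lt_top le_rfl).ne]
        congr 2
        rw [ENNReal.ofReal_pow (by norm_num)]
        norm_num

lemma decay_mul_decay_le_wB {u σ R : ℝ} (hσ : 0 < σ) (hR : 0 < R) (hu : |u| ≤ 3 / 2)
    (c x : ℝ × ℝ) :
    decay 100 (σ * ((parabMap u σ x).1 - (parabMap u σ c).1) / (σ ^ 2 * R)) *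
        decay 100 (((parabMap u σ x).2 - (parabMap u σ c).2) / (σ ^ 2 * R)) ≤
      ENNReal.ofReal (4 ^ 100) * ENNReal.ofReal (wB c R x) := by
  set a : ℝ := (x.1 - c.1) / R with ha
  set b : ℝ := (x.2 - c.2) / R with hb
  have e1 : σ * ((parabMap u σ x).1 - (parabMap u σ c).1) / (σ ^ 2 * R) = a + 2 * u * b := by
    unfold parabMap
    simp only [ha, hb]
    field_simp
    ring
  have e2 : ((parabMap u σ x).2 - (parabMap u σ c).2) / (σ ^ 2 * R) = b := by
    unfold parabMap
    simp only [hb]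
    field_simp
  rw [e1, e2, wB_eq c R x]
  unfold decay
  rw [← ENNReal.ofReal_mul (by positivity), ← ENNReal.ofReal_mul (by positivity)]
  refine ENNReal.ofReal_le_ofReal ?_
  rw [← mul_inv, ← mul_pow, ← div_eq_mul_inv, le_div_iff₀ (by positivity),
    inv_mul_le_iff₀ (by positivity), mul_comm _ ((4 : ℝ) ^ 100), ← mul_pow]
  refine pow_le_pow_left₀ (by positivity) ?_ _
  have h1 : √((x.1 - c.1) ^ 2 + (x.2 - c.2) ^ 2) / R ≤ |a| + |b| := by
    rw [div_le_iff₀ hR]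
    refine Real.sqrt_le_iff.2 ⟨by positivity, ?_⟩
    have h1 : |a| * R = |x.1 - c.1| := by rw [ha, abs_div, abs_of_pos hR]; field_simp
    have h2 : |b| * R = |x.2 - c.2| := by rw [hb, abs_div, abs_of_pos hR]; field_simp
    rw [add_mul, h1, h2, ← sq_abs (x.1 - c.1), ← sq_abs (x.2 - c.2)]
    nlinarith [abs_nonneg (x.1 - c.1), abs_nonneg (x.2 - c.2)]
  have h2 : |a| ≤ |a + 2 * u * b| + 3 * |b| := by
    have h3 : |2 * u * b| ≤ 3 * |b| := by
      rw [abs_mul, abs_mul, abs_two]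
      exact mul_le_mul_of_nonneg_right (by linarith) (abs_nonneg _)
    have h4 := abs_sub (a + 2 * u * b) (2 * u * b)
    rw [add_sub_cancel_right] at h4
    linarith
  nlinarith [abs_nonneg (a + 2 * u * b), abs_nonneg b,
    mul_nonneg (abs_nonneg (a + 2 * u * b)) (abs_nonneg b)]

lemma one_le_average_indicator_sqr {u σ R M : ℝ} (hσ : 0 < σ) (hσ1 : σ ≤ 1) (hR : 0 < R)
    (hM : M = σ ^ 2 * R) (hu : |u| ≤ 3 / 2) {c x : ℝ × ℝ} (hx : x ∈ sqr c R) :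
    1 ≤ ENNReal.ofReal M⁻¹ * ∫⁻ α in Set.Icc (-(3 * M / σ)) (3 * M / σ),
      (sqr 0 M).indicator (fun _ => (1 : ℝ≥0∞))
        (parabMap u σ x - (parabMap u σ c + (α, 0))) := by
  have hM0 : 0 < M := by rw [hM]; positivity
  set a : ℝ := (parabMap u σ x).1 - (parabMap u σ c).1 with ha
  have hx1 : |x.1 - c.1| ≤ R / 2 := by
    have := hx.1
    rw [abs_le]; constructor <;> linarith [this.1, this.2]
  have hx2 : |x.2 - c.2| ≤ R / 2 := by
    have := hx.2
    rw [abs_le]; constructor <;> linarith [this.1, this.2]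
  have h2 : |(parabMap u σ x).2 - (parabMap u σ c).2| ≤ M / 2 := by
    have e : (parabMap u σ x).2 - (parabMap u σ c).2 = σ ^ 2 * (x.2 - c.2) := by
      unfold parabMap; ring
    rw [e, abs_mul, abs_of_pos (by positivity), hM]
    nlinarith [sq_nonneg σ]
  have hMσ : M / σ = σ * R := by rw [hM]; field_simp
  have hMle : M ≤ M / σ := by rw [le_div_iff₀ hσ]; nlinarith
  have h1 : |a| ≤ 2 * (M / σ) := by
    have e : a = σ * ((x.1 - c.1) + 2 * u * (x.2 - c.2)) := by
      rw [ha]; unfold parabMap; ring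
    rw [e, abs_mul, abs_of_pos hσ, hMσ]
    have h3 : |2 * u * (x.2 - c.2)| ≤ 3 * (R / 2) := by
      rw [abs_mul, abs_mul, abs_two]
      exact mul_le_mul (by linarith) hx2 (abs_nonneg _) (by norm_num)
    have h4 := abs_add_le (x.1 - c.1) (2 * u * (x.2 - c.2))
    nlinarith
  have hsub : Set.Icc (a - M / 2) (a + M / 2) ⊆ Set.Icc (-(3 * M / σ)) (3 * M / σ) := by
    have h5 := abs_le.1 h1
    have e : 3 * M / σ = 3 * (M / σ) := by ring
    rw [e]
    exact Set.Icc_subset_Icc (by linarith) (by linarith)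
  calc (1 : ℝ≥0∞) = ENNReal.ofReal M⁻¹ * ∫⁻ α in Set.Icc (a - M / 2) (a + M / 2), 1 := by
        rw [setLIntegral_const, Real.volume_Icc, one_mul, ← ENNReal.ofReal_mul (by positivity)]
        rw [show a + M / 2 - (a - M / 2) = M by ring, inv_mul_cancel₀ hM0.ne',
          ENNReal.ofReal_one]
    _ ≤ ENNReal.ofReal M⁻¹ * ∫⁻ α in Set.Icc (a - M / 2) (a + M / 2),
          (sqr 0 M).indicator (fun _ => (1 : ℝ≥0∞))
            (parabMap u σ x - (parabMap u σ c + (α, 0))) := by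
        refine mul_le_mul_right (setLIntegral_mono' measurableSet_Icc fun α hα => ?_) _
        rw [Set.indicator_of_mem]
        have h6 := abs_le.1 h2
        refine ⟨⟨?_, ?_⟩, ⟨?_, ?_⟩⟩ <;>
          simp only [Prod.fst_zero, Prod.snd_zero, Prod.fst_sub, Prod.snd_sub, Prod.fst_add,
            Prod.snd_add] <;> linarith [hα.1, hα.2]
    _ ≤ _ := mul_le_mul_right (lintegral_mono_set hsub) _

lemma lintegral_sqr_comp_parabMap_le {u σ R M : ℝ} (hσ : 0 < σ) (hσ1 : σ ≤ 1) (hR : 0 < R)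
    (hM : M = σ ^ 2 * R) (hu : |u| ≤ 3 / 2) (c : ℝ × ℝ) {F : ℝ × ℝ → ℝ≥0∞} (hF : Measurable F) :
    ∫⁻ x in sqr c R, F (parabMap u σ x) ≤
      ENNReal.ofReal (σ ^ 3)⁻¹ * (ENNReal.ofReal M⁻¹ *
        ∫⁻ α in Set.Icc (-(3 * M / σ)) (3 * M / σ), ∫⁻ y in sqr 0 M,
          F (parabMap u σ c + (α, 0) + y)) := by
  set S := Set.Icc (-(3 * M / σ)) (3 * M / σ)
  set y₀ := parabMap u σ c
  obtain ⟨χ, hχ, hχm⟩ : ∃ χ : ℝ × ℝ → ℝ≥0∞,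
      (∀ y, χ y = (sqr 0 M).indicator (fun _ => (1 : ℝ≥0∞)) y) ∧ Measurable χ :=
    ⟨_, fun _ => rfl, measurable_const.indicator (measurableSet_sqr 0 M)⟩
  have hm : Measurable (Function.uncurry fun (y : ℝ × ℝ) (α : ℝ) => χ (y - (y₀ + (α, 0)))) := by
    unfold Function.uncurry
    fun_prop
  have hW : Measurable fun y => ENNReal.ofReal M⁻¹ * ∫⁻ α in S, χ (y - (y₀ + (α, 0))) :=
    measurable_const.mul (Measurable.lintegral_prod_right hm)
  calc ∫⁻ x in sqr c R, F (parabMap u σ x)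
      ≤ ∫⁻ x in sqr c R, (ENNReal.ofReal M⁻¹ *
          ∫⁻ α in S, χ (parabMap u σ x - (y₀ + (α, 0)))) * F (parabMap u σ x) := by
        refine setLIntegral_mono' (measurableSet_sqr c R) fun x hx => ?_
        refine le_mul_of_one_le_left' ?_
        simp_rw [hχ]
        exact one_le_average_indicator_sqr hσ hσ1 hR hM hu hx
    _ ≤ ∫⁻ x, (ENNReal.ofReal M⁻¹ *
          ∫⁻ α in S, χ (parabMap u σ x - (y₀ + (α, 0)))) * F (parabMap u σ x) :=
        setLIntegral_le_lintegral _ _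
    _ = ENNReal.ofReal (σ ^ 3)⁻¹ * ∫⁻ y, (ENNReal.ofReal M⁻¹ *
          ∫⁻ α in S, χ (y - (y₀ + (α, 0)))) * F y :=
        lintegral_comp_parabMap hσ (hW.mul hF)
    _ = ENNReal.ofReal (σ ^ 3)⁻¹ * (ENNReal.ofReal M⁻¹ *
          ∫⁻ y, ∫⁻ α in S, χ (y - (y₀ + (α, 0))) * F y) := by
        rw [← lintegral_const_mul' (ENNReal.ofReal M⁻¹) _ ENNReal.ofReal_ne_top]
        congr 2 with y
        rw [lintegral_mul_const _ (by fun_prop), mul_assoc]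
    _ = ENNReal.ofReal (σ ^ 3)⁻¹ * (ENNReal.ofReal M⁻¹ *
          ∫⁻ α in S, ∫⁻ y, χ (y - (y₀ + (α, 0))) * F y) := by
        rw [lintegral_lintegral_swap (by unfold Function.uncurry; fun_prop)]
    _ = _ := by
        congr 3 with α
        rw [← lintegral_add_left_eq_self _ (y₀ + (α, 0)),
          ← lintegral_indicator (measurableSet_sqr 0 M)]
        congr 1 with y
        rw [add_sub_cancel_left, hχ]
        by_cases hy : y ∈ sqr 0 M <;> simp [hy]

lemma exists_average_decay_le : ∃ C : ℝ≥0, ∀ M σ : ℝ, 0 < M → 0 < σ → σ ≤ 1 → ∀ y₀ : ℝ × ℝ,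
    ∀ H : ℝ × ℝ → ℝ≥0∞, Measurable H →
    ENNReal.ofReal M⁻¹ * ∫⁻ α in Set.Icc (-(3 * M / σ)) (3 * M / σ), ∫⁻ τ, decay 100 (τ / M) *
        ∫⁻ x, decay 102 (x / M) * H (y₀ + (α, 0) + (x, τ)) ≤
      C * ∫⁻ y, decay 100 (σ * (y.1 - y₀.1) / M) * decay 100 ((y.2 - y₀.2) / M) * H y := by
  obtain ⟨C, hC⟩ := exists_lintegral_decay_average_le
  refine ⟨C, fun M σ hM hσ hσ1 y₀ H hH => ?_⟩
  set S := Set.Icc (-(3 * M / σ)) (3 * M / σ)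
  have hshift : ∀ α τ, ∫⁻ x, decay 102 (x / M) * H (y₀ + (α, 0) + (x, τ)) =
      ∫⁻ x, decay 102 ((x - α) / M) * H (y₀ + (x, τ)) := by
    intro α τ
    rw [← lintegral_sub_right_eq_self (fun x => decay 102 (x / M) * H (y₀ + (α, 0) + (x, τ))) α]
    congr 1 with x
    congr 2
    ext <;> simp
  calc _ = ENNReal.ofReal M⁻¹ * ∫⁻ α in S, ∫⁻ τ, ∫⁻ x,
        decay 100 (τ / M) * (decay 102 ((x - α) / M) * H (y₀ + (x, τ))) := by
        simp_rw [hshift]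
        congr 3 with α
        congr 1 with τ
        rw [lintegral_const_mul _ (by fun_prop)]
    _ = ∫⁻ τ, ∫⁻ x, (ENNReal.ofReal M⁻¹ * ∫⁻ α in S, decay 102 ((x - α) / M)) *
          (decay 100 (τ / M) * H (y₀ + (x, τ))) := by
        rw [lintegral_lintegral_swap, ← lintegral_const_mul' _ _ ENNReal.ofReal_ne_top]
        · congr 1 with τ
          rw [lintegral_lintegral_swap (by unfold Function.uncurry; fun_prop),
            ← lintegral_const_mul' _ _ ENNReal.ofReal_ne_top]
          congr 1 with x
          rw [mul_assoc, ← lintegral_mul_const _ (by fun_prop)]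
          refine congrArg _ (lintegral_congr fun α => ?_)
          exact mul_left_comm _ _ _
        · refine Measurable.aemeasurable ?_
          exact Measurable.lintegral_prod_right (f := fun (q : ℝ × ℝ) (x : ℝ) =>
            decay 100 (q.2 / M) * (decay 102 ((x - q.1) / M) * H (y₀ + (x, q.2))))
            (by unfold Function.uncurry; fun_prop)
    _ ≤ ∫⁻ τ, ∫⁻ x, (C * decay 100 (σ * x / M)) * (decay 100 (τ / M) * H (y₀ + (x, τ))) :=
        lintegral_mono fun τ => lintegral_mono fun x =>
          mul_le_mul_left (hC M σ hM hσ hσ1 x) _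
    _ = ∫⁻ z : ℝ × ℝ, (C * decay 100 (σ * z.1 / M)) * (decay 100 (z.2 / M) * H (y₀ + z)) := by
        rw [Measure.volume_eq_prod, lintegral_prod_symm _ (by fun_prop)]
    _ = _ := by
        rw [← lintegral_add_left_eq_self (fun y : ℝ × ℝ => _ * _ * H y) y₀,
          ← lintegral_const_mul' _ _ ENNReal.coe_ne_top]
        congr 1 with z
        simp only [Prod.fst_add, Prod.snd_add, add_sub_cancel_left]
        ring

/-- Decoupling on a short interval, for functions supported in the middle of each piece. -/
lemma exists_lintegral_sqr_sum_le :
    ∃ C : ℝ≥0, ∀ p : ℝ, 4 < p → p < 6 → ∀ n m : ℕ, 0 < m → m ≤ n → ∀ D : ℝ, 0 ≤ D →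
    DecIneq p m D → ∀ u : ℝ, |u| ≤ 3 / 2 → ∀ G : ℕ → ℝ → ℂ, (∀ k, Integrable (G k)) →
    (∀ k : ℕ, ∀ t, G k t ≠ 0 →
      u + ((k : ℝ) + 1 / 6) / n ≤ t ∧ t ≤ u + ((k : ℝ) + 5 / 6) / n) →
    ∀ c : ℝ × ℝ, ∫⁻ y in sqr c ((n : ℝ) ^ 2),
        ‖parabExt (fun t => ∑ k ∈ Finset.range m, G k t) y‖ₑ ^ p ≤
      C * ENNReal.ofReal D ^ p * lpSq p m (fun k =>
        ∫⁻ y, ‖parabExt (G k) y‖ₑ ^ p * ENNReal.ofReal (wB c ((n : ℝ) ^ 2) y)) := by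
  obtain ⟨C₁, hloc⟩ := exists_local_decoupling
  obtain ⟨C₂, hav⟩ := exists_average_decay_le
  refine ⟨C₁ * (C₂ * 4 ^ 100), fun p hp4 hp6 n m hm hmn D hD hDec u hu G hG hs c => ?_⟩
  have hp0 : 0 < p := by linarith
  have hm0 : (0 : ℝ) < m := by exact_mod_cast hm
  have hmn' : (m : ℝ) ≤ n := by exact_mod_cast hmn
  have hn0 : (0 : ℝ) < n := hm0.trans_le hmn'
  obtain ⟨σ, hσ⟩ : ∃ σ : ℝ, σ = m / n := ⟨_, rfl⟩
  have hσ0 : 0 < σ := by rw [hσ]; positivity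
  have hσ1 : σ ≤ 1 := by rw [hσ, div_le_one hn0]; exact hmn'
  have hM : (m : ℝ) ^ 2 = σ ^ 2 * (n : ℝ) ^ 2 := by rw [hσ]; field_simp
  have hM0 : (0 : ℝ) < (m : ℝ) ^ 2 := by positivity
  obtain ⟨M, hMdef⟩ : ∃ M : ℝ, M = (m : ℝ) ^ 2 := ⟨_, rfl⟩
  set h : ℕ → ℝ → ℂ := fun k t => σ * G k (u + σ * t) with hh
  have hhi : ∀ k, Integrable (h k) := fun k =>
    (((hG k).comp_add_left u).comp_mul_left' hσ0.ne').const_mul _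
  have hhs : ∀ k : ℕ, ∀ t, h k t ≠ 0 → ((k : ℝ) + 1 / 6) / m ≤ t ∧ t ≤ ((k : ℝ) + 5 / 6) / m := by
    intro k t ht
    obtain ⟨h1, h2⟩ := hs k _ (right_ne_zero_of_mul ht)
    have h1 : ((k : ℝ) + 1 / 6) / n ≤ σ * t := by linarith
    have h2 : σ * t ≤ ((k : ℝ) + 5 / 6) / n := by linarith
    have e : σ * t = (t * m) / n := by rw [hσ]; ring
    rw [e, div_le_div_iff_of_pos_right hn0] at h1 h2
    exact ⟨by rwa [div_le_iff₀ hm0], by rwa [le_div_iff₀ hm0]⟩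
  obtain ⟨H, hH⟩ : ∃ H : ℕ → ℝ × ℝ → ℝ≥0∞, ∀ k y, H k y = ‖parabExt (h k) y‖ₑ ^ p :=
    ⟨_, fun _ _ => rfl⟩
  have hHm : ∀ k, Measurable (H k) := fun k => by
    rw [show H k = fun y => ‖parabExt (h k) y‖ₑ ^ p from funext (hH k)]
    exact (measurable_enorm_parabExt (hhi k)).pow_const p
  obtain ⟨F, hF⟩ : ∃ F : ℝ × ℝ → ℝ≥0∞, ∀ y, F y =
    ‖parabExt (fun t => ∑ k ∈ Finset.range m, h k t) y‖ₑ ^ p := ⟨_, fun _ => rfl⟩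
  have hFm : Measurable F := by
    rw [show F = _ from funext hF]
    exact (measurable_enorm_parabExt (integrable_finsetSum _ fun k _ => hhi k)).pow_const p
  have hLHS : ∀ x, ‖parabExt (fun t => ∑ k ∈ Finset.range m, G k t) x‖ₑ ^ p =
      F (parabMap u σ x) := by
    intro x
    rw [enorm_parabExt_rescale (u := u) hσ0, hF]
    simp only [hh, Finset.mul_sum]
  set S := Set.Icc (-(3 * M / σ)) (3 * M / σ)
  set y₀ := parabMap u σ c
  have hlocal : ∀ α, ∫⁻ y in sqr 0 M, F (y₀ + (α, 0) + y) ≤ C₁ * ENNReal.ofReal D ^ p *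
      lpSq p m (fun k => ∫⁻ τ, decay 100 (τ / M) *
        ∫⁻ x, decay 102 (x / M) * H k (y₀ + (α, 0) + (x, τ))) := by
    intro α
    have h1 := hloc p hp4 hp6 m hm D hD hDec h hhi hhs (y₀ + (α, 0))
    simp_rw [← hF, ← hH, ← hMdef] at h1
    refine h1.trans (mul_le_mul_right ?_ _)
    simp_rw [← lpSq_const_mul hp0]
    refine lintegral_lpSq_le (by linarith) m (fun k => ?_)
    have hHk := hHm k
    refine (measurable_decay 100).comp (by fun_prop : Measurable fun τ => τ / M) |>.mul ?_
    exact Measurable.lintegral_prod_right (f := fun (τ : ℝ) (x : ℝ) =>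
      decay 102 (x / M) * H k (y₀ + (α, 0) + (x, τ))) (by unfold Function.uncurry; fun_prop)
  have hinner : ∀ k, Measurable fun α : ℝ => ∫⁻ τ, decay 100 (τ / M) *
        ∫⁻ x, decay 102 (x / M) * H k (y₀ + (α, 0) + (x, τ)) := by
    intro k
    have hHk := hHm k
    refine Measurable.lintegral_prod_right (f := fun (α τ : ℝ) => decay 100 (τ / M) *
        ∫⁻ x, decay 102 (x / M) * H k (y₀ + (α, 0) + (x, τ))) ?_
    unfold Function.uncurry
    refine Measurable.mul (by fun_prop) ?_
    exact Measurable.lintegral_prod_right (f := fun (q : ℝ × ℝ) (x : ℝ) =>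
      decay 102 (x / M) * H k (y₀ + (q.1, 0) + (x, q.2))) (by unfold Function.uncurry; fun_prop)
  have hweight : ∀ k, ENNReal.ofReal (σ ^ 3)⁻¹ *
      ∫⁻ y, decay 100 (σ * (y.1 - y₀.1) / M) * decay 100 ((y.2 - y₀.2) / M) * H k y ≤
      4 ^ 100 * ∫⁻ y, ‖parabExt (G k) y‖ₑ ^ p * ENNReal.ofReal (wB c ((n : ℝ) ^ 2) y) := by
    intro k
    have hHk := hHm k
    rw [← lintegral_comp_parabMap hσ0 (u := u) (by fun_prop),
      ← lintegral_const_mul' _ _ (by finiteness)]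
    refine lintegral_mono fun x => ?_
    have h1 := decay_mul_decay_le_wB hσ0 (R := (n : ℝ) ^ 2) (by positivity) hu c x
    rw [← hM, ← hMdef] at h1
    have h2 : H k (parabMap u σ x) = ‖parabExt (G k) x‖ₑ ^ p := by
      rw [hH, enorm_parabExt_rescale hσ0 (G k)]
    rw [h2]
    refine (mul_le_mul_left h1 _).trans (le_of_eq ?_)
    rw [ENNReal.ofReal_pow (by norm_num), ENNReal.ofReal_ofNat]
    ring
  have hconst : (C₁ : ℝ≥0∞) * ENNReal.ofReal D ^ p ≠ ⊤ := ENNReal.mul_ne_top ENNReal.coe_ne_top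
    (ENNReal.rpow_ne_top_of_nonneg hp0.le ENNReal.ofReal_ne_top)
  simp_rw [hLHS]
  calc _ ≤ ENNReal.ofReal (σ ^ 3)⁻¹ * (ENNReal.ofReal M⁻¹ *
        ∫⁻ α in S, ∫⁻ y in sqr 0 M, F (y₀ + (α, 0) + y)) :=
        lintegral_sqr_comp_parabMap_le hσ0 hσ1 (by positivity) (hMdef.trans hM) hu c hFm
    _ ≤ ENNReal.ofReal (σ ^ 3)⁻¹ * (ENNReal.ofReal M⁻¹ * (C₁ * ENNReal.ofReal D ^ p *
          lpSq p m (fun k => ∫⁻ α in S, ∫⁻ τ, decay 100 (τ / M) *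
            ∫⁻ x, decay 102 (x / M) * H k (y₀ + (α, 0) + (x, τ))))) := by
        refine mul_le_mul_right (mul_le_mul_right ?_ _) _
        refine (lintegral_mono hlocal).trans ?_
        rw [lintegral_const_mul' _ _ hconst]
        exact mul_le_mul_right (lintegral_lpSq_le (by linarith) m hinner) _
    _ = C₁ * ENNReal.ofReal D ^ p * lpSq p m (fun k => ENNReal.ofReal (σ ^ 3)⁻¹ *
          (ENNReal.ofReal M⁻¹ * ∫⁻ α in S, ∫⁻ τ, decay 100 (τ / M) *
            ∫⁻ x, decay 102 (x / M) * H k (y₀ + (α, 0) + (x, τ)))) := by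
        rw [lpSq_const_mul hp0, lpSq_const_mul hp0]
        ring
    _ ≤ C₁ * ENNReal.ofReal D ^ p * lpSq p m (fun k => (C₂ * 4 ^ 100) *
          ∫⁻ y, ‖parabExt (G k) y‖ₑ ^ p * ENNReal.ofReal (wB c ((n : ℝ) ^ 2) y)) := by
        refine mul_le_mul_right (lpSq_mono hp0 fun k _ => ?_) _
        calc _ ≤ ENNReal.ofReal (σ ^ 3)⁻¹ * (C₂ * ∫⁻ y,
              decay 100 (σ * (y.1 - y₀.1) / M) * decay 100 ((y.2 - y₀.2) / M) * H k y) :=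
              mul_le_mul_right (hav M σ (hMdef ▸ hM0) hσ0 hσ1 y₀ (H k) (hHm k)) _
          _ = C₂ * (ENNReal.ofReal (σ ^ 3)⁻¹ * ∫⁻ y,
              decay 100 (σ * (y.1 - y₀.1) / M) * decay 100 ((y.2 - y₀.2) / M) * H k y) := by ring
          _ ≤ _ := by
              rw [mul_assoc]
              exact mul_le_mul_right (hweight k) _
    _ = _ := by
        rw [lpSq_const_mul hp0]
        push_cast
        ring

lemma ofReal_wB_sub_le {c : ℝ × ℝ} {R A : ℝ} (hR : 0 < R) (hA : |A| ≤ R) (x s r : ℝ) :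
    ENNReal.ofReal (wB c R (x - A * r, s)) ≤ growth 100 r * ENNReal.ofReal (wB c R (x, s)) := by
  unfold growth
  rw [← ENNReal.ofReal_mul (by positivity), wB_eq, wB_eq]
  refine ENNReal.ofReal_le_ofReal ?_
  rw [← div_eq_mul_inv, le_div_iff₀ (by positivity), inv_mul_le_iff₀ (by positivity), ← mul_pow]
  refine pow_le_pow_left₀ (by positivity) ?_ _
  simp only []
  set S := √((x - A * r - c.1) ^ 2 + (s - c.2) ^ 2) with hS
  have hS0 : 0 ≤ S := Real.sqrt_nonneg _
  have hS2 : S ^ 2 = (x - A * r - c.1) ^ 2 + (s - c.2) ^ 2 := Real.sq_sqrt (by positivity)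
  have hSa : |x - A * r - c.1| ≤ S := Real.abs_le_sqrt (by nlinarith [sq_nonneg (s - c.2)])
  have h1 : √((x - c.1) ^ 2 + (s - c.2) ^ 2) ≤ S + R * |r| := by
    have h2 : √((x - c.1) ^ 2 + (s - c.2) ^ 2) ≤ S + |A * r| := by
      refine Real.sqrt_le_iff.2 ⟨by positivity, ?_⟩
      have h3 : (x - A * r - c.1) * (A * r) ≤ S * |A * r| :=
        (le_abs_self _).trans (by rw [abs_mul]; gcongr)
      have h4 := sq_abs (A * r)
      nlinarith
    refine h2.trans ?_
    rw [abs_mul]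
    gcongr
  calc 1 + √((x - c.1) ^ 2 + (s - c.2) ^ 2) / R ≤ 1 + (S + R * |r|) / R := by gcongr
    _ = 1 + S / R + |r| := by field_simp; ring
    _ ≤ (1 + S / R) * (1 + |r|) := by
        nlinarith [mul_nonneg (div_nonneg hS0 hR.le) (abs_nonneg r)]

lemma exists_cutoff_lintegral_le :
    ∃ (θ : ℝ → ℂ) (C : ℝ≥0), Continuous θ ∧ (∀ x, ‖θ x‖ ≤ 1) ∧ (∀ x, |x| ≤ 1 / 3 → θ x = 1) ∧
      (∀ x, 2 / 3 ≤ |x| → θ x = 0) ∧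
      ∀ p : ℝ, 4 < p → p < 6 → ∀ A B R : ℝ, 0 < R → |A| ≤ R → ∀ c : ℝ × ℝ, ∀ h : ℝ → ℂ,
        Integrable h →
        ∫⁻ y, ‖parabExt (fun t => θ (A * t + B) * h t) y‖ₑ ^ p * ENNReal.ofReal (wB c R y) ≤
          C * ∫⁻ y, ‖parabExt h y‖ₑ ^ p * ENNReal.ofReal (wB c R y) := by
  obtain ⟨φ, f, hφ, hf0, hf1, hfa, hfb⟩ :=
    exists_schwartz_cutoff (a := 1 / 3) (b := 2 / 3) (by norm_num) (by norm_num)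
  obtain ⟨ν, hν⟩ := exists_schwartz_kernel φ
  set K := 1 + ∫⁻ r, ‖ν r‖ₑ * growth 100 r with hK
  have hKt : K ^ 6 ≠ ⊤ := ENNReal.pow_ne_top
    (ENNReal.add_ne_top.2 ⟨ENNReal.one_ne_top, (schwartz_lintegral_growth_lt_top ν 100).ne⟩)
  refine ⟨φ, (K ^ 6).toNNReal, φ.continuous, fun x => ?_, fun x hx => ?_, fun x hx => ?_, ?_⟩
  · rw [hφ, Complex.norm_real, Real.norm_of_nonneg (hf0 x)]
    exact hf1 x
  · rw [hφ, hfa x hx, Complex.ofReal_one]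
  · rw [hφ, hfb x hx, Complex.ofReal_zero]
  intro p hp4 hp6 A B R hR hA c h hh
  have hφh : Integrable fun t => φ (A * t + B) * h t := by
    refine hh.bdd_mul (c := 1) (Continuous.aestronglyMeasurable
      (φ.continuous.comp (by fun_prop : Continuous fun t => A * t + B)))
      (Filter.Eventually.of_forall fun t => ?_)
    rw [hφ, Complex.norm_real, Real.norm_of_nonneg (hf0 _)]
    exact hf1 _
  have hw : Measurable fun y => ENNReal.ofReal (wB c R y) := (measurable_wB c R).ennreal_ofReal
  have hKp : (∫⁻ r, ‖ν r‖ₑ * growth 100 r) ^ p ≤ K ^ 6 :=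
    (ENNReal.rpow_le_rpow (by rw [hK]; exact self_le_add_left _ _) (by linarith)).trans
      (rpow_le_pow_six (by rw [hK]; exact self_le_add_right _ _) hp6.le)
  have hfub : ∀ F : ℝ → ℂ, Integrable F →
      ∫⁻ y, ‖parabExt F y‖ₑ ^ p * ENNReal.ofReal (wB c R y) =
        ∫⁻ s, ∫⁻ x, ‖parabExt F (x, s)‖ₑ ^ p * ENNReal.ofReal (wB c R (x, s)) := fun F hF => by
    rw [Measure.volume_eq_prod]
    exact lintegral_prod_symm _ (((measurable_enorm_parabExt hF).pow_const p).mul hw).aemeasurable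
  rw [ENNReal.coe_toNNReal hKt, hfub _ hφh, hfub h hh, ← lintegral_const_mul' _ _ hKt]
  refine lintegral_mono fun s => ?_
  simp_rw [hν]
  refine (lintegral_parabExt_multiplier_le (by linarith) hh ν.integrable ν.continuous A B s
    (v := fun x => ENNReal.ofReal (wB c R (x, s))) (c := growth 100)
    (hw.comp (by fun_prop)) (measurable_growth 100) (one_le_growth 100)
    (fun x r => ofReal_wB_sub_le hR hA x s r)).trans ?_
  exact mul_le_mul_left hKp _

lemma parabExt_add {h₁ h₂ : ℝ → ℂ} (hh₁ : Integrable h₁) (hh₂ : Integrable h₂) (y : ℝ × ℝ) :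
    parabExt (fun t => h₁ t + h₂ t) y = parabExt h₁ y + parabExt h₂ y := by
  unfold parabExt
  simp_rw [add_mul]
  exact integral_add (integrable_mul_unitChar hh₁ (by fun_prop))
    (integrable_mul_unitChar hh₂ (by fun_prop))

lemma parabExt_sub {h₁ h₂ : ℝ → ℂ} (hh₁ : Integrable h₁) (hh₂ : Integrable h₂) (y : ℝ × ℝ) :
    parabExt (fun t => h₁ t - h₂ t) y = parabExt h₁ y - parabExt h₂ y := by
  unfold parabExt
  simp_rw [sub_mul]
  exact integral_sub (integrable_mul_unitChar hh₁ (by fun_prop))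
    (integrable_mul_unitChar hh₂ (by fun_prop))

lemma add_rpow_le_of_lt_six {p : ℝ} (hp4 : 4 < p) (hp6 : p < 6) (a b : ℝ≥0∞) :
    (a + b) ^ p ≤ 64 * (a ^ p + b ^ p) := by
  refine (ENNReal.rpow_add_le_mul_rpow_add_rpow a b (by linarith)).trans
    (mul_le_mul_left ?_ _)
  calc (2 : ℝ≥0∞) ^ (p - 1) ≤ 2 ^ (6 : ℝ) :=
        ENNReal.rpow_le_rpow_of_exponent_le (by norm_num) (by linarith)
    _ = 64 := by
        rw [show (6 : ℝ) = ((6 : ℕ) : ℝ) by norm_num, ENNReal.rpow_natCast]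
        norm_num

/-- Each function splits into two parts, each supported in the middle of a shifted piece. -/
lemma exists_split_pieces :
    ∃ C : ℝ≥0, ∀ p : ℝ, 4 < p → p < 6 → ∀ n : ℕ, 0 < n → ∀ u : ℝ, ∀ g : ℕ → ℝ → ℂ,
    (∀ k, Integrable (g k)) →
    (∀ k : ℕ, ∀ t, g k t ≠ 0 → u + (k : ℝ) / n ≤ t ∧ t ≤ u + ((k : ℝ) + 1) / n) →
    ∃ g₁ g₂ : ℕ → ℝ → ℂ, (∀ k t, g k t = g₁ k t + g₂ k t) ∧
      (∀ k, Integrable (g₁ k)) ∧ (∀ k, Integrable (g₂ k)) ∧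
      (∀ k : ℕ, ∀ t, g₁ k t ≠ 0 → u - 1 / (6 * n) + ((k : ℝ) + 1 / 6) / n ≤ t ∧
        t ≤ u - 1 / (6 * n) + ((k : ℝ) + 5 / 6) / n) ∧
      (∀ k : ℕ, ∀ t, g₂ k t ≠ 0 → u + 1 / (6 * n) + ((k : ℝ) + 1 / 6) / n ≤ t ∧
        t ≤ u + 1 / (6 * n) + ((k : ℝ) + 5 / 6) / n) ∧
      ∀ c : ℝ × ℝ, ∀ k,
        ∫⁻ y, ‖parabExt (g₁ k) y‖ₑ ^ p * ENNReal.ofReal (wB c ((n : ℝ) ^ 2) y) ≤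
          C * ∫⁻ y, ‖parabExt (g k) y‖ₑ ^ p * ENNReal.ofReal (wB c ((n : ℝ) ^ 2) y) ∧
        ∫⁻ y, ‖parabExt (g₂ k) y‖ₑ ^ p * ENNReal.ofReal (wB c ((n : ℝ) ^ 2) y) ≤
          C * ∫⁻ y, ‖parabExt (g k) y‖ₑ ^ p * ENNReal.ofReal (wB c ((n : ℝ) ^ 2) y) := by
  obtain ⟨θ, C, hθc, hθ1, hθa, hθb, hθ⟩ := exists_cutoff_lintegral_le
  refine ⟨64 * (1 + C), fun p hp4 hp6 n hn u g hg hs => ?_⟩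
  have hn0 : (1 : ℝ) ≤ n := by exact_mod_cast hn
  have hn1 : (0 : ℝ) < n := by linarith
  set g₁ : ℕ → ℝ → ℂ := fun k t => θ (n * t + -(n * u + k)) * g k t with hg₁
  have hi₁ : ∀ k, Integrable (g₁ k) := fun k =>
    (hg k).bdd_mul (c := 1) (by fun_prop) (Filter.Eventually.of_forall fun t => hθ1 _)
  have hcoord : ∀ (k : ℕ) t, g k t ≠ 0 →
      0 ≤ (n : ℝ) * t + -(n * u + k) ∧ (n : ℝ) * t + -(n * u + k) ≤ 1 := by
    intro k t ht
    obtain ⟨h1, h2⟩ := hs k t ht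
    have h1 : (k : ℝ) / n ≤ t - u := by linarith
    have h2 : t - u ≤ ((k : ℝ) + 1) / n := by linarith
    rw [div_le_iff₀ hn1] at h1
    rw [le_div_iff₀ hn1] at h2
    constructor <;> linarith
  have hle : ∀ a b t : ℝ, a ≤ n * t → n * t ≤ b → a / n ≤ t ∧ t ≤ b / n := fun a b t h1 h2 =>
    ⟨by rw [div_le_iff₀ hn1]; linarith, by rw [le_div_iff₀ hn1]; linarith⟩
  refine ⟨g₁, fun k t => g k t - g₁ k t, fun k t => by ring, hi₁, fun k => (hg k).sub (hi₁ k),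
    fun k t ht => ?_, fun k t ht => ?_, fun c k => ?_⟩
  · have hne := mul_ne_zero_iff.1 ht
    have h1 := hcoord k t hne.2
    have h2 : |(n : ℝ) * t + -(n * u + k)| < 2 / 3 := by
      by_contra hcon
      exact hne.1 (hθb _ (not_lt.1 hcon))
    rw [abs_of_nonneg h1.1] at h2
    convert hle (n * u + k) (n * u + k + 2 / 3) t (by linarith) (by linarith) using 2 <;>
    · field_simp
      ring
  · have hg0 : g k t ≠ 0 := fun h0 => ht (by simp [hg₁, h0])
    have h1 := hcoord k t hg0
    have h2 : 1 / 3 < |(n : ℝ) * t + -(n * u + k)| := by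
      by_contra hcon
      exact ht (by simp only [hg₁]; rw [hθa _ (not_lt.1 hcon)]; ring)
    rw [abs_of_nonneg h1.1] at h2
    convert hle (n * u + k + 1 / 3) (n * u + k + 1) t (by linarith) (by linarith) using 2 <;>
    · field_simp
      ring
  · have hbound := hθ p hp4 hp6 n (-(n * u + k)) ((n : ℝ) ^ 2) (by positivity)
      (by rw [abs_of_pos hn1]; nlinarith) c (g k) (hg k)
    set W := ∫⁻ y, ‖parabExt (g k) y‖ₑ ^ p * ENNReal.ofReal (wB c ((n : ℝ) ^ 2) y) with hW
    have hw : Measurable fun y => ENNReal.ofReal (wB c ((n : ℝ) ^ 2) y) :=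
      (measurable_wB c _).ennreal_ofReal
    constructor
    · refine hbound.trans (mul_le_mul_left ?_ _)
      push_cast
      calc (C : ℝ≥0∞) ≤ 1 * (1 + C) := by rw [one_mul]; exact self_le_add_left _ _
        _ ≤ _ := mul_le_mul_left (by norm_num) _
    · calc ∫⁻ y, ‖parabExt (fun t => g k t - g₁ k t) y‖ₑ ^ p *
            ENNReal.ofReal (wB c ((n : ℝ) ^ 2) y)
          ≤ ∫⁻ y, 64 * (‖parabExt (g k) y‖ₑ ^ p * ENNReal.ofReal (wB c ((n : ℝ) ^ 2) y) +
              ‖parabExt (g₁ k) y‖ₑ ^ p * ENNReal.ofReal (wB c ((n : ℝ) ^ 2) y)) := by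
            refine lintegral_mono fun y => ?_
            rw [← add_mul, ← mul_assoc]
            refine mul_le_mul_left ?_ _
            rw [parabExt_sub (hg k) (hi₁ k)]
            exact (ENNReal.rpow_le_rpow enorm_sub_le (by linarith)).trans
              (add_rpow_le_of_lt_six hp4 hp6 _ _)
        _ = 64 * (W + ∫⁻ y, ‖parabExt (g₁ k) y‖ₑ ^ p *
              ENNReal.ofReal (wB c ((n : ℝ) ^ 2) y)) := by
            rw [lintegral_const_mul' _ _ (by norm_num), lintegral_add_left]
            exact ((measurable_enorm_parabExt (hg k)).pow_const p).mul hw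
        _ ≤ 64 * (W + C * W) := mul_le_mul_right (add_le_add_right hbound _) _
        _ = _ := by push_cast; ring

lemma exists_lintegral_sqr_pieces_le :
    ∃ C : ℝ≥0, ∀ p : ℝ, 4 < p → p < 6 → ∀ n m : ℕ, 0 < m → m ≤ n → ∀ D : ℝ, 0 ≤ D →
    DecIneq p m D → ∀ u : ℝ, 0 ≤ u → u ≤ 1 → ∀ g : ℕ → ℝ → ℂ, (∀ k, Integrable (g k)) →
    (∀ k : ℕ, ∀ t, g k t ≠ 0 → u + (k : ℝ) / n ≤ t ∧ t ≤ u + ((k : ℝ) + 1) / n) →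
    ∀ c : ℝ × ℝ, ∫⁻ y in sqr c ((n : ℝ) ^ 2),
        ‖parabExt (fun t => ∑ k ∈ Finset.range m, g k t) y‖ₑ ^ p ≤
      C * ENNReal.ofReal D ^ p * lpSq p m (fun k =>
        ∫⁻ y, ‖parabExt (g k) y‖ₑ ^ p * ENNReal.ofReal (wB c ((n : ℝ) ^ 2) y)) := by
  obtain ⟨C₁, hsplit⟩ := exists_split_pieces
  obtain ⟨C₂, hmid⟩ := exists_lintegral_sqr_sum_le
  refine ⟨64 * (C₂ * C₁ + C₂ * C₁), fun p hp4 hp6 n m hm hmn D hD hDec u hu0 hu1 g hg hs c => ?_⟩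
  have hp0 : 0 < p := by linarith
  have hn : 0 < n := hm.trans_le hmn
  have hn1 : (1 : ℝ) ≤ n := by exact_mod_cast hn
  obtain ⟨g₁, g₂, hadd, hi₁, hi₂, hs₁, hs₂, hb⟩ := hsplit p hp4 hp6 n hn u g hg hs
  have hfrac : (1 : ℝ) / (6 * n) ≤ 1 / 6 := by gcongr; linarith
  have hfrac0 : (0 : ℝ) ≤ 1 / (6 * n) := by positivity
  have hpart : ∀ v : ℝ, |v| ≤ 3 / 2 → ∀ G : ℕ → ℝ → ℂ, (∀ k, Integrable (G k)) →
      (∀ k : ℕ, ∀ t, G k t ≠ 0 →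
        v + ((k : ℝ) + 1 / 6) / n ≤ t ∧ t ≤ v + ((k : ℝ) + 5 / 6) / n) →
      (∀ k, ∫⁻ y, ‖parabExt (G k) y‖ₑ ^ p * ENNReal.ofReal (wB c ((n : ℝ) ^ 2) y) ≤
          C₁ * ∫⁻ y, ‖parabExt (g k) y‖ₑ ^ p * ENNReal.ofReal (wB c ((n : ℝ) ^ 2) y)) →
      ∫⁻ y in sqr c ((n : ℝ) ^ 2),
        ‖parabExt (fun t => ∑ k ∈ Finset.range m, G k t) y‖ₑ ^ p ≤
      C₂ * C₁ * ENNReal.ofReal D ^ p * lpSq p m (fun k =>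
        ∫⁻ y, ‖parabExt (g k) y‖ₑ ^ p * ENNReal.ofReal (wB c ((n : ℝ) ^ 2) y)) := by
    intro v hv G hGi hGs hGb
    refine (hmid p hp4 hp6 n m hm hmn D hD hDec v hv G hGi hGs c).trans ?_
    refine (mul_le_mul_right (lpSq_mono hp0 fun k _ => hGb k) _).trans (le_of_eq ?_)
    rw [lpSq_const_mul hp0]
    ring
  have hI₁ := integrable_finsetSum (Finset.range m) fun k _ => hi₁ k
  have hI₂ := integrable_finsetSum (Finset.range m) fun k _ => hi₂ k
  have hpt : ∀ y, ‖parabExt (fun t => ∑ k ∈ Finset.range m, g k t) y‖ₑ ^ p ≤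
      64 * (‖parabExt (fun t => ∑ k ∈ Finset.range m, g₁ k t) y‖ₑ ^ p +
        ‖parabExt (fun t => ∑ k ∈ Finset.range m, g₂ k t) y‖ₑ ^ p) := by
    intro y
    simp_rw [hadd, Finset.sum_add_distrib]
    rw [parabExt_add hI₁ hI₂]
    exact (ENNReal.rpow_le_rpow (enorm_add_le _ _) hp0.le).trans
      (add_rpow_le_of_lt_six hp4 hp6 _ _)
  refine (lintegral_mono hpt).trans ?_
  rw [lintegral_const_mul' _ _ (by norm_num), lintegral_add_left]
  · refine (mul_le_mul_right (add_le_add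
      (hpart _ (abs_le.2 ⟨by linarith, by linarith⟩) g₁ hi₁ hs₁ fun k => (hb c k).1)
      (hpart _ (abs_le.2 ⟨by linarith, by linarith⟩) g₂ hi₂ hs₂ fun k => (hb c k).2))
      _).trans (le_of_eq ?_)
    push_cast
    ring
  · exact (measurable_enorm_parabExt hI₁).pow_const p

/-- Parabolic rescaling: for `δ = 1/n`, `σ = m/n` with `1 < m ≤ n`, and an
interval `I = [u, u+σ] ⊆ [0,1]`, decoupling on `I` into intervals of `P_δ(I)` costs an absolute
constant times `D_p(δ/σ) = D_p(1/m)`. -/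
theorem parabolic_rescaling :
    ∃ c : ℝ, 0 < c ∧ ∀ p : ℝ, 4 < p → p < 6 → ∀ n m : ℕ, 1 < m → m ≤ n →
      ∀ u : ℝ, 0 ≤ u → u + (m : ℝ) / n ≤ 1 →
      ∀ g : ℝ → ℂ, IntegrableOn g (Set.Icc 0 1) → ∀ cB : ℝ × ℝ,
        sqLp p cB ((n : ℝ) ^ 2) (extOp u (u + (m : ℝ) / n) g) ≤
          c * Dconst p m *
            (∑ k ∈ Finset.range m,
              wLp p (wB cB ((n : ℝ) ^ 2))
                (extOp (u + (k : ℝ) / n) (u + ((k : ℝ) + 1) / n) g) ^ 2) ^ (1 / 2 : ℝ) := by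
  obtain ⟨C, hC⟩ := exists_lintegral_sqr_pieces_le
  refine ⟨C + 1, by positivity, fun p hp4 hp6 n m hm hmn u hu hu1 g hg cB => ?_⟩
  have hp0 : 0 < p := by linarith
  have hm0 : 0 < m := by omega
  have hn0 : (0 : ℝ) < n := by exact_mod_cast hm0.trans_le hmn
  have hD := Dconst_nonneg p m
  have hDec := decIneq_Dconst (p := p) (by linarith) hm0
  have hum : u ≤ 1 := by linarith [show (0 : ℝ) ≤ (m : ℝ) / n by positivity]
  set G : ℕ → ℝ → ℂ := fun k => if k < m then
    (Set.Ico (u + (k : ℝ) / n) (u + ((k : ℝ) + 1) / n)).indicator g else 0 with hG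
  have hGk : ∀ k < m, G k = (Set.Ico (u + (k : ℝ) / n) (u + ((k : ℝ) + 1) / n)).indicator g :=
    fun k hk => if_pos hk
  have hGi : ∀ k, Integrable (G k) := by
    intro k
    by_cases hk : k < m
    · rw [hGk k hk]
      refine integrable_indicator_Ico hg (by positivity) (le_trans ?_ hu1)
      gcongr
      exact_mod_cast hk
    · rw [show G k = 0 from if_neg hk]
      exact integrable_zero _ _ _
  have hGs : ∀ k : ℕ, ∀ t, G k t ≠ 0 → u + (k : ℝ) / n ≤ t ∧ t ≤ u + ((k : ℝ) + 1) / n := by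
    intro k t ht
    by_cases hk : k < m
    · rw [hGk k hk] at ht
      have h1 := Set.mem_of_indicator_ne_zero ht
      exact ⟨h1.1, h1.2.le⟩
    · exact absurd (congrFun (show G k = 0 from if_neg hk) t) ht
  have hsum : (Set.Ico u (u + (m : ℝ) / n)).indicator g =
      fun t => ∑ k ∈ Finset.range m, G k t := by
    funext t
    rw [indicator_Ico_eq_sum hn0]
    exact Finset.sum_congr rfl fun k hk => by rw [hGk k (Finset.mem_range.1 hk)]
  have hrhs : ∀ k ∈ Finset.range m, wLp p (wB cB ((n : ℝ) ^ 2))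
      (extOp (u + (k : ℝ) / n) (u + ((k : ℝ) + 1) / n) g) ^ 2 =
        wLp p (wB cB ((n : ℝ) ^ 2)) (parabExt (G k)) ^ 2 := fun k hk => by
    rw [extOp_eq_parabExt, hGk k (Finset.mem_range.1 hk)]
  rw [Finset.sum_congr rfl hrhs, extOp_eq_parabExt, hsum,
    sqLp_le_iff hp0 (integrable_finsetSum _ fun k _ => hGi k) (fun k _ => hGi k) cB
      (by positivity) (by positivity)]
  refine (hC p hp4 hp6 n m hm0 hmn _ hD hDec u hu hum G hGi hGs cB).trans (mul_le_mul_left ?_ _)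
  rw [ENNReal.ofReal_mul (by positivity), ENNReal.mul_rpow_of_nonneg _ _ hp0.le]
  refine mul_le_mul_left ?_ _
  have h1 : ENNReal.ofReal ((C : ℝ) + 1) = C + 1 := by
    rw [ENNReal.ofReal_add (by positivity) (by norm_num), ENNReal.ofReal_coe_nnreal,
      ENNReal.ofReal_one]
  rw [h1]
  calc (C : ℝ≥0∞) ≤ (C + 1) ^ (1 : ℝ) := by rw [ENNReal.rpow_one]; exact self_le_add_right _ _
    _ ≤ _ := ENNReal.rpow_le_rpow_of_exponent_le (self_le_add_left _ _) (by linarith)
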